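/- arXiv:2506.22429 — 2 statements merged into one kernel-verified Lean document; each statement's English description precedes it below -/
import Mathlib

section
/- For every k ∈ ℕ₀ there exists a constant b_k > 0 such that for each τ ∈ {−1, 1} the function t ↦ ŝ_k(τ(1−t)) − (−τ)^{k+1}·b_k·t^{k+1/2}, defined on (0,2), belongs to the class Q_{−1, k+1/2}. -/
open MeasureTheory ProbabilityTheory Filter Set

noncomputable section

/-- The standard Gaussian measure `N(0,1)` on `ℝ`. -/
def stdGaussian : Measure ℝ := gaussianReal 0 1

/-- The dual activation `φ̂(t) = E[φ(σ₊X + σ₋Y) φ(σ₊X − σ₋Y)]` with `X, Y` i.i.d. `N(0,1)`,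
`σ₊ = √((1+t)/2)`, `σ₋ = √((1−t)/2)`. -/
def dualAct (φ : ℝ → ℝ) (t : ℝ) : ℝ :=
  ∫ p : ℝ × ℝ,
    φ (Real.sqrt ((1 + t) / 2) * p.1 + Real.sqrt ((1 - t) / 2) * p.2) *
    φ (Real.sqrt ((1 + t) / 2) * p.1 - Real.sqrt ((1 - t) / 2) * p.2)
    ∂(stdGaussian.prod stdGaussian)

/-- The reference activation `s_k(x) = sgn(x) x^k / (2 k!)`. -/
def refAct (k : ℕ) (x : ℝ) : ℝ := Real.sign x * x ^ k / (2 * k.factorial)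

/-- `P_{α,β}`: finite sums of real powers `t^{α_i}` on `(0,2)`, where integer exponents
exceed `α` and non-integer exponents exceed `β`. -/
def Pclass (α β : ℝ) : Set (ℝ → ℝ) :=
  { f | ∃ (n : ℕ) (a : Fin n → ℝ) (e : Fin n → ℝ),
      (∀ i, (∃ z : ℤ, e i = (z : ℝ)) → α < e i) ∧
      (∀ i, (¬ ∃ z : ℤ, e i = (z : ℝ)) → β < e i) ∧
      (∀ t ∈ Set.Ioo (0 : ℝ) 2, f t = ∑ i, a i * t ^ (e i)) }

/-- `R_{γ'}`: functions that are `C^∞` on `(0,2)` and whose `m`-th derivatives are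
`O(t^{γ'-m})` as `t ↓ 0`. -/
def Rclass (γ' : ℝ) : Set (ℝ → ℝ) :=
  { f | ContDiffOn ℝ (⊤ : ℕ∞) f (Set.Ioo (0 : ℝ) 2) ∧
      ∀ m : ℕ, ∃ C : ℝ, ∃ ε > (0 : ℝ), ∀ t ∈ Set.Ioo (0 : ℝ) (min ε 2),
        |iteratedDerivWithin m f (Set.Ioo (0 : ℝ) 2) t| ≤ C * t ^ (γ' - m) }

/-- `Q_{α,β} = ∩_{γ'} (P_{α,β} + R_{γ'})` (as functions on `(0,2)`). -/
def Qclass (α β : ℝ) : Set (ℝ → ℝ) :=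
  { f | ∀ γ' : ℝ, ∃ p ∈ Pclass α β, ∃ r ∈ Rclass γ',
      ∀ t ∈ Set.Ioo (0 : ℝ) 2, f t = p t + r t }


lemma Rclass_bound {γ : ℝ} {f : ℝ → ℝ} (hf : f ∈ Rclass γ) (m : ℕ) :
    ∃ C : ℝ, 0 ≤ C ∧ ∃ ε > (0 : ℝ), ε ≤ 1 ∧ ∀ t ∈ Set.Ioo (0 : ℝ) ε,
      |iteratedDerivWithin m f (Set.Ioo (0 : ℝ) 2) t| ≤ C * t ^ (γ - m) := by
  obtain ⟨C, ε, hε, h⟩ := hf.2 m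
  refine ⟨max C 0, le_max_right _ _, min ε 1, by positivity, min_le_right _ _, ?_⟩
  intro t ht
  have h1 := ht.2
  rw [lt_min_iff] at h1
  have ht0 : 0 < t := ht.1
  refine (h t ⟨ht0, lt_min h1.1 (by linarith)⟩).trans ?_
  gcongr
  exact le_max_left _ _

lemma Rclass_mk {γ : ℝ} {f : ℝ → ℝ} (hf : ContDiffOn ℝ (⊤ : ℕ∞) f (Set.Ioo (0 : ℝ) 2))
    (h : ∀ m : ℕ, ∃ C : ℝ, ∃ ε > (0 : ℝ), ∀ t ∈ Set.Ioo (0 : ℝ) ε, t < 1 →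
      |iteratedDerivWithin m f (Set.Ioo (0 : ℝ) 2) t| ≤ C * t ^ (γ - m)) : f ∈ Rclass γ := by
  refine ⟨hf, fun m => ?_⟩
  obtain ⟨C, ε, hε, h⟩ := h m
  refine ⟨C, min ε 1, by positivity, ?_⟩
  intro t ht
  have h1 := ht.2
  simp only [lt_min_iff] at h1
  exact h t ⟨ht.1, h1.1.1⟩ h1.1.2

lemma Rclass_mono {γ γ' : ℝ} (h : γ' ≤ γ) {f : ℝ → ℝ} (hf : f ∈ Rclass γ) : f ∈ Rclass γ' := by
  refine Rclass_mk hf.1 fun m => ?_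
  obtain ⟨C, hC, ε, hε, hε1, hb⟩ := Rclass_bound hf m
  refine ⟨C, ε, hε, fun t ht ht1 => (hb t ht).trans ?_⟩
  have := Real.rpow_le_rpow_of_exponent_ge ht.1 ht1.le (sub_le_sub_right h (m : ℝ))
  gcongr

lemma Rclass_congr {γ : ℝ} {f g : ℝ → ℝ} (hf : f ∈ Rclass γ)
    (h : ∀ t ∈ Ioo (0 : ℝ) 2, g t = f t) : g ∈ Rclass γ := by
  refine ⟨hf.1.congr h, fun m => ?_⟩
  obtain ⟨C, ε, hε, hb⟩ := hf.2 m
  refine ⟨C, ε, hε, fun t ht => ?_⟩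
  have h2 : t ∈ Ioo (0 : ℝ) 2 := ⟨ht.1, ht.2.trans_le (min_le_right _ _)⟩
  rw [iteratedDerivWithin_congr (n := m) (show Set.EqOn g f (Ioo 0 2) from h) h2]
  exact hb t ht

lemma Rclass_mul {a b : ℝ} {f g : ℝ → ℝ} (hf : f ∈ Rclass a) (hg : g ∈ Rclass b) :
    (fun t => f t * g t) ∈ Rclass (a + b) := by
  refine Rclass_mk (hf.1.mul hg.1) fun m => ?_
  choose C hC ε hε hε1 hb using Rclass_bound hf
  choose C' hC' ε' hε' hε1' hb' using Rclass_bound hg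
  obtain ⟨δ, hδ, hδ2⟩ : ∃ δ > (0 : ℝ), ∀ i ∈ Finset.range (m + 1), δ ≤ min (ε i) (ε' (m - i)) := by
    refine ⟨(Finset.range (m + 1)).inf' (by simp) (fun i => min (ε i) (ε' (m - i))), ?_, ?_⟩
    · rw [gt_iff_lt, Finset.lt_inf'_iff]
      exact fun i _ => lt_min (hε _) (hε' _)
    · exact fun i hi => Finset.inf'_le _ hi
  refine ⟨∑ i ∈ Finset.range (m + 1), (m.choose i : ℝ) * C i * C' (m - i), δ, hδ, ?_⟩
  intro t ht ht1
  have h2 : t ∈ Ioo (0 : ℝ) 2 := ⟨ht.1, by linarith⟩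
  have := norm_iteratedFDerivWithin_mul_le hf.1 hg.1 isOpen_Ioo.uniqueDiffOn h2 (n := m)
    (by exact_mod_cast le_top)
  simp only [norm_iteratedFDerivWithin_eq_norm_iteratedDerivWithin, Real.norm_eq_abs] at this
  refine this.trans ?_
  rw [Finset.sum_mul]
  refine Finset.sum_le_sum fun i hi => ?_
  have hδ' := hδ2 i hi
  rw [le_min_iff] at hδ'
  have e1 := hb i t ⟨ht.1, ht.2.trans_le hδ'.1⟩
  have e2 := hb' (m - i) t ⟨ht.1, ht.2.trans_le hδ'.2⟩
  have hi' : i ≤ m := by simpa [Nat.lt_succ_iff] using hi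
  have e3 : t ^ (a - i) * t ^ (b - (m - i : ℕ)) = t ^ (a + b - m) := by
    rw [← Real.rpow_add ht.1]
    congr 1
    push_cast [hi']
    ring
  have ht0 := ht.1
  have hC1 := hC i
  have hC2 := hC' (m - i)
  calc _ ≤ (m.choose i : ℝ) * (C i * t ^ (a - i)) * (C' (m - i) * t ^ (b - (m - i : ℕ))) := by
        gcongr
    _ = _ := by rw [← e3]; ring

lemma Rclass_rpow (a : ℝ) : (fun t : ℝ => t ^ a) ∈ Rclass a := by
  refine Rclass_mk ?_ fun m => ?_
  · intro x hx
    exact (Real.contDiffAt_rpow_const_of_ne hx.1.ne').contDiffWithinAt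
  · refine ⟨|(descPochhammer ℝ m).eval a|, 1, one_pos, fun t ht ht1 => ?_⟩
    rw [iteratedDerivWithin_of_isOpen_eq_iterate isOpen_Ioo ⟨ht.1, by linarith⟩,
      Real.iter_deriv_rpow_const, abs_mul, abs_of_nonneg (Real.rpow_nonneg ht.1.le _)]

lemma Rclass_of_smooth {h : ℝ → ℝ} (hh : ContDiffOn ℝ (⊤ : ℕ∞) h (Iio 2)) : h ∈ Rclass 0 := by
  refine Rclass_mk (hh.mono Ioo_subset_Iio_self) fun m => ?_
  have hc : ContinuousOn (iteratedDerivWithin m h (Iio 2)) (Iio 2) :=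
    hh.continuousOn_iteratedDerivWithin (by exact_mod_cast le_top) isOpen_Iio.uniqueDiffOn
  obtain ⟨C, hC⟩ := (isCompact_Icc (a := (0:ℝ)) (b := 1)).exists_bound_of_continuousOn
    (hc.mono (fun x hx => lt_of_le_of_lt hx.2 (by norm_num)))
  refine ⟨C, 1, one_pos, fun t ht ht1 => ?_⟩
  have h1 := hC t ⟨ht.1.le, ht1.le⟩
  have h3 : iteratedDerivWithin m h (Ioo 0 2) t = iteratedDerivWithin m h (Iio 2) t :=
    iteratedDerivWithin_congr_right_of_isOpen h m isOpen_Ioo isOpen_Iio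
      ⟨⟨ht.1, by linarith⟩, by simp; linarith⟩
  rw [h3]
  have hC0 : 0 ≤ C := (norm_nonneg _).trans h1
  refine h1.trans (le_mul_of_one_le_right hC0 ?_)
  exact Real.one_le_rpow_of_pos_of_le_one_of_nonpos ht.1 ht1.le (by simp)

lemma Rclass_anti {γ : ℝ} (hγ : -1 < γ) {F r : ℝ → ℝ} (hr : r ∈ Rclass γ)
    (hF : ∀ t ∈ Ioo (0 : ℝ) 2, HasDerivAt F (r t) t) :
    ∃ c : ℝ, (fun t => F t - c) ∈ Rclass (γ + 1) := by
  obtain ⟨C, hC, ε, hε, hε1, hb⟩ := Rclass_bound hr 0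
  simp only [iteratedDerivWithin_zero, Nat.cast_zero, sub_zero] at hb
  have hγ1 : 0 < γ + 1 := by linarith
  set H : ℝ → ℝ := fun t => C / (γ + 1) * t ^ (γ + 1) with hH
  have hHd : ∀ t ∈ Ioo (0 : ℝ) ε, HasDerivAt H (C * t ^ γ) t := by
    intro t ht
    have := (Real.hasDerivAt_rpow_const (x := t) (p := γ + 1) (Or.inl ht.1.ne')).const_mul (C / (γ + 1))
    refine this.congr_deriv ?_
    rw [add_sub_cancel_right]
    field_simp
  have hsub : ∀ t ∈ Ioo (0 : ℝ) ε, t ∈ Ioo (0 : ℝ) 2 := fun t ht => ⟨ht.1, by linarith [ht.2]⟩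
  have hmono : MonotoneOn (fun t => F t + H t) (Ioo 0 ε) := by
    refine monotoneOn_of_deriv_nonneg (convex_Ioo _ _) ?_ ?_ ?_
    · exact fun t ht => ((hF t (hsub t ht)).add (hHd t ht)).continuousAt.continuousWithinAt
    · rw [interior_Ioo]
      exact fun t ht => ((hF t (hsub t ht)).add (hHd t ht)).differentiableAt.differentiableWithinAt
    · rw [interior_Ioo]
      intro t ht
      rw [((hF t (hsub t ht)).fun_add (hHd t ht)).deriv]
      linarith [(abs_le.1 (hb t ht)).1]
  have hanti : AntitoneOn (fun t => F t - H t) (Ioo 0 ε) := by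
    refine antitoneOn_of_deriv_nonpos (convex_Ioo _ _) ?_ ?_ ?_
    · exact fun t ht => ((hF t (hsub t ht)).sub (hHd t ht)).continuousAt.continuousWithinAt
    · rw [interior_Ioo]
      exact fun t ht => ((hF t (hsub t ht)).sub (hHd t ht)).differentiableAt.differentiableWithinAt
    · rw [interior_Ioo]
      intro t ht
      rw [((hF t (hsub t ht)).fun_sub (hHd t ht)).deriv]
      linarith [(abs_le.1 (hb t ht)).2]
  have hH0 : ∀ t ∈ Ioo (0 : ℝ) ε, 0 ≤ H t := fun t ht => by
    have := ht.1
    simp only [hH]; positivity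
  have hcross : ∀ s ∈ Ioo (0 : ℝ) ε, ∀ t ∈ Ioo (0 : ℝ) ε, F s - H s ≤ F t + H t := by
    intro s hs t ht
    have hu : min s t ∈ Ioo (0 : ℝ) ε := ⟨lt_min hs.1 ht.1, (min_le_left _ _).trans_lt hs.2⟩
    have e1 := hanti hu hs (min_le_left _ _)
    have e2 := hmono hu ht (min_le_right _ _)
    have e3 := hH0 _ hu
    simp only at e1 e2
    linarith
  have hmem : ε / 2 ∈ Ioo (0 : ℝ) ε := ⟨by linarith, by linarith⟩
  set c := sSup ((fun s => F s - H s) '' Ioo 0 ε) with hc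
  have hc1 : ∀ t ∈ Ioo (0 : ℝ) ε, F t - H t ≤ c := by
    intro t ht
    refine le_csSup ⟨F (ε / 2) + H (ε / 2), ?_⟩ ⟨t, ht, rfl⟩
    rintro _ ⟨s, hs, rfl⟩
    exact hcross s hs _ hmem
  have hc2 : ∀ t ∈ Ioo (0 : ℝ) ε, c ≤ F t + H t := by
    intro t ht
    refine csSup_le ⟨_, ε / 2, hmem, rfl⟩ ?_
    rintro _ ⟨s, hs, rfl⟩
    exact hcross s hs _ ht
  have hd : Set.EqOn (derivWithin (fun t => F t - c) (Ioo 0 2)) r (Ioo 0 2) := fun t ht =>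
    ((hF t ht).sub_const c).hasDerivWithinAt.derivWithin (isOpen_Ioo.uniqueDiffOn t ht)
  refine ⟨c, Rclass_mk ?_ ?_⟩
  · refine (contDiffOn_infty_iff_derivWithin isOpen_Ioo.uniqueDiffOn).2 ⟨?_, ?_⟩
    · exact fun t ht => ((hF t ht).sub_const c).differentiableAt.differentiableWithinAt
    · exact hr.1.congr hd
  · rintro (_ | m)
    · refine ⟨C / (γ + 1), ε, hε, fun t ht _ => ?_⟩
      simp only [iteratedDerivWithin_zero, Nat.cast_zero, sub_zero]
      have e1 := hc1 t ht
      have e2 := hc2 t ht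
      simp only [hH] at e1 e2
      rw [abs_le]
      constructor <;> linarith
    · obtain ⟨C', hC', ε', hε', hε1', hb'⟩ := Rclass_bound hr m
      refine ⟨C', ε', hε', fun t ht ht1 => ?_⟩
      rw [iteratedDerivWithin_succ', iteratedDerivWithin_congr hd ⟨ht.1, by linarith⟩]
      convert hb' t ht using 3
      push_cast
      ring

lemma Pclass_anti {β : ℝ} (hβ : -1 ≤ β) {p : ℝ → ℝ} (hp : p ∈ Pclass (-1) β) :
    ∃ P : ℝ → ℝ, (∀ c : ℝ, (fun t => P t + c) ∈ Pclass (-1) (β + 1)) ∧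
      ∀ t ∈ Ioo (0 : ℝ) 2, HasDerivAt P (p t) t := by
  obtain ⟨n, a, e, h1, h2, h3⟩ := hp
  have he : ∀ i, -1 < e i := by
    intro i
    by_cases h : ∃ z : ℤ, e i = (z : ℝ)
    · exact h1 i h
    · exact hβ.trans_lt (h2 i h)
  have hint : ∀ i, (∃ z : ℤ, e i + 1 = (z : ℝ)) → ∃ z : ℤ, e i = (z : ℝ) := by
    rintro i ⟨z, hz⟩
    exact ⟨z - 1, by push_cast; linarith⟩
  have hint' : ∀ i, (∃ z : ℤ, e i = (z : ℝ)) → ∃ z : ℤ, e i + 1 = (z : ℝ) := by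
    rintro i ⟨z, hz⟩
    exact ⟨z + 1, by push_cast; linarith⟩
  refine ⟨fun t => ∑ i, a i / (e i + 1) * t ^ (e i + 1), fun c => ?_, fun t ht => ?_⟩
  · refine ⟨n + 1, Fin.cons c (fun i => a i / (e i + 1)), Fin.cons 0 (fun i => e i + 1), ?_, ?_, ?_⟩
    · intro i
      refine Fin.cases ?_ (fun i => ?_) i
      · intro _; simp
      · intro _
        simp only [Fin.cons_succ]
        linarith [he i]
    · intro i
      refine Fin.cases ?_ (fun i => ?_) i
      · intro h
        exact absurd ⟨0, by simp⟩ h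
      · intro h
        simp only [Fin.cons_succ] at h ⊢
        linarith [h2 i (fun h' => h (hint' i h'))]
    · intro t ht
      simp [Fin.sum_univ_succ, add_comm]
  · rw [h3 t ht]
    refine HasDerivAt.fun_sum fun i _ => ?_
    have := (Real.hasDerivAt_rpow_const (x := t) (p := e i + 1) (Or.inl ht.1.ne')).const_mul
      (a i / (e i + 1))
    refine this.congr_deriv ?_
    have : e i + 1 ≠ 0 := by linarith [he i]
    rw [add_sub_cancel_right]
    field_simp

lemma Qclass_anti {β : ℝ} (hβ : -1 ≤ β) {f F : ℝ → ℝ} (hf : f ∈ Qclass (-1) β)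
    (hF : ∀ t ∈ Ioo (0 : ℝ) 2, HasDerivAt F (f t) t) : F ∈ Qclass (-1) (β + 1) := by
  intro γ'
  obtain ⟨p, hp, r, hr, h⟩ := hf (max γ' 0)
  obtain ⟨P, hP, hPd⟩ := Pclass_anti hβ hp
  obtain ⟨c, hc⟩ := Rclass_anti (F := fun t => F t - P t) (γ := max γ' 0)
    (by linarith [le_max_right γ' 0]) hr
    (fun t ht => by
      have := (hF t ht).fun_sub (hPd t ht)
      rwa [h t ht, add_sub_cancel_left] at this)
  refine ⟨_, hP c, _, Rclass_mono (γ' := γ') (by linarith [le_max_left γ' 0]) hc, ?_⟩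
  intro t _
  ring

lemma Qclass_smul {α β : ℝ} {f g : ℝ → ℝ} (c : ℝ) (hf : f ∈ Qclass α β)
    (hg : ∀ t ∈ Ioo (0 : ℝ) 2, g t = c * f t) : g ∈ Qclass α β := by
  intro γ'
  obtain ⟨p, ⟨n, a, e, h1, h2, h3⟩, r, hr, h⟩ := hf γ'
  refine ⟨fun t => c * p t, ⟨n, fun i => c * a i, e, h1, h2, ?_⟩, fun t => c * r t, ?_, ?_⟩
  · intro t ht
    simp only [h3 t ht, Finset.mul_sum, mul_assoc]
  · have := Rclass_mul (Rclass_of_smooth (h := fun _ => c) contDiffOn_const) hr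
    rwa [zero_add] at this
  · intro t ht
    rw [hg t ht, h t ht]
    ring

lemma taylor_R (N : ℕ) : ∀ h : ℝ → ℝ, ContDiffOn ℝ (⊤ : ℕ∞) h (Iio 2) →
    ∃ a : ℕ → ℝ, (fun t => h t - ∑ i ∈ Finset.range N, a i * t ^ i) ∈ Rclass N := by
  induction N with
  | zero =>
    intro h hh
    refine ⟨0, ?_⟩
    simpa using Rclass_of_smooth hh
  | succ N ih =>
    intro h hh
    obtain ⟨hd, hh'⟩ := (contDiffOn_infty_iff_deriv_of_isOpen isOpen_Iio).1 hh
    obtain ⟨a, ha⟩ := ih _ hh'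
    obtain ⟨c, hc⟩ := Rclass_anti (F := fun t => h t - ∑ i ∈ Finset.range N, a i / (i + 1) * t ^ (i + 1))
      (by linarith [Nat.cast_nonneg (α := ℝ) N]) ha (fun t ht => by
        refine HasDerivAt.fun_sub ?_ (HasDerivAt.fun_sum fun i _ => ?_)
        · exact ((hd t ht.2).differentiableAt (isOpen_Iio.mem_nhds ht.2)).hasDerivAt
        · have := (hasDerivAt_pow (i + 1) t).const_mul (a i / (i + 1))
          refine this.congr_deriv ?_
          have : (i : ℝ) + 1 ≠ 0 := by positivity
          push_cast
          field_simp)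
    refine ⟨fun i => Nat.casesOn i c (fun i => a i / (i + 1)), ?_⟩
    push_cast
    refine Rclass_congr hc fun t _ => ?_
    rw [Finset.sum_range_succ']
    simp
    ring

lemma base_Q {h : ℝ → ℝ} (hh : ContDiffOn ℝ (⊤ : ℕ∞) h (Iio 2)) :
    (fun t : ℝ => t ^ (-(1 / 2) : ℝ) * h t - h 0 * t ^ (-(1 / 2) : ℝ)) ∈
      Qclass (-1) (-(1 / 2)) := by
  intro γ'
  obtain ⟨M, hM⟩ := exists_nat_ge γ'
  obtain ⟨a, ha⟩ := taylor_R (M + 1) h hh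
  have ha0 : a 0 = h 0 := by
    obtain ⟨C, hC, ε, hε, hε1, hb⟩ := Rclass_bound ha 0
    simp only [iteratedDerivWithin_zero, Nat.cast_zero, sub_zero, Real.rpow_natCast] at hb
    have hcont : ContinuousAt h 0 := hh.continuousOn.continuousAt (isOpen_Iio.mem_nhds (by simp))
    have e1 : Tendsto (fun t => h t - ∑ i ∈ Finset.range (M + 1), a i * t ^ i) (nhdsWithin 0 (Ioi 0))
        (nhds (h 0 - a 0)) := by
      have : ContinuousAt (fun t => h t - ∑ i ∈ Finset.range (M + 1), a i * t ^ i) 0 := by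
        fun_prop
      have h2 := this.tendsto.mono_left (nhdsWithin_le_nhds (s := Ioi 0))
      simpa [Finset.sum_range_succ'] using h2
    have e2 : Tendsto (fun t => h t - ∑ i ∈ Finset.range (M + 1), a i * t ^ i) (nhdsWithin 0 (Ioi 0))
        (nhds 0) := by
      have h3 : Tendsto (fun t : ℝ => C * t ^ (M + 1)) (nhdsWithin 0 (Ioi 0)) (nhds 0) := by
        have : ContinuousAt (fun t : ℝ => C * t ^ (M + 1)) 0 := by fun_prop
        simpa using this.tendsto.mono_left (nhdsWithin_le_nhds (s := Ioi 0))
      refine squeeze_zero_norm' ?_ h3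
      filter_upwards [Ioo_mem_nhdsGT hε] with t ht
      exact hb t ht
    linarith [tendsto_nhds_unique e1 e2]
  have hR := Rclass_mul (Rclass_rpow (-(1 / 2))) ha
  refine ⟨fun t => ∑ i : Fin M, a (i + 1) * t ^ ((i : ℝ) + 1 / 2),
    ⟨M, fun i => a (i + 1), fun i => (i : ℝ) + 1 / 2, ?_, ?_, fun t _ => rfl⟩, _,
    Rclass_mono (γ' := γ') ?_ hR, ?_⟩
  · intro i _
    linarith [Nat.cast_nonneg (α := ℝ) (i : ℕ)]
  · intro i _
    linarith [Nat.cast_nonneg (α := ℝ) (i : ℕ)]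
  · push_cast
    linarith
  · intro t ht
    rw [Finset.sum_range_succ', ← ha0, Finset.sum_range]
    have : ∑ i : Fin M, a (i + 1) * t ^ ((i : ℝ) + 1 / 2)
        = t ^ (-(1 / 2) : ℝ) * ∑ i : Fin M, a (i + 1) * t ^ ((i : ℕ) + 1) := by
      rw [Finset.mul_sum]
      refine Finset.sum_congr rfl fun i _ => ?_
      have : t ^ ((i : ℝ) + 1 / 2) = t ^ (-(1 / 2) : ℝ) * t ^ ((i : ℕ) + 1) := by
        rw [← Real.rpow_natCast, ← Real.rpow_add ht.1]
        congr 1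
        push_cast
        ring
      rw [this]; ring
    simp only [this, pow_zero]
    ring

/-- `sgn(x) x^k`. -/
def Sfun (k : ℕ) (x : ℝ) : ℝ := Real.sign x * x ^ k

/-- The angular integral. -/
def Jfun (k : ℕ) (ρ : ℝ) : ℝ := ∫ u in (0 : ℝ)..Real.pi, Sfun k (Real.cos u + ρ)

lemma measurable_rsign : Measurable Real.sign := by
  unfold Real.sign
  exact Measurable.ite measurableSet_Iio measurable_const
    (Measurable.ite measurableSet_Ioi measurable_const measurable_const)

lemma measurable_Sfun (k : ℕ) : Measurable (Sfun k) :=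
  measurable_rsign.mul (measurable_id.pow_const k)

lemma abs_rsign_le (x : ℝ) : |Real.sign x| ≤ 1 := by
  rcases Real.sign_apply_eq x with h | h | h <;> simp [h]

lemma Sfun_intervalIntegrable (k : ℕ) (ρ a b : ℝ) :
    IntervalIntegrable (fun u => Sfun k (Real.cos u + ρ)) volume a b := by
  have h1 : IntervalIntegrable (fun _ : ℝ => (1 + |ρ|) ^ k) volume a b := intervalIntegrable_const
  refine h1.mono_fun' ?_ ?_
  · exact ((measurable_Sfun k).comp (by fun_prop)).aestronglyMeasurable
  · refine Filter.Eventually.of_forall fun u => ?_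
    simp only [Sfun, Real.norm_eq_abs, abs_mul, abs_pow]
    have e1 := abs_rsign_le (Real.cos u + ρ)
    have e2 : |Real.cos u + ρ| ≤ 1 + |ρ| :=
      (abs_add_le _ _).trans (by linarith [Real.abs_cos_le_one u])
    calc _ ≤ 1 * (1 + |ρ|) ^ k := by gcongr
      _ = _ := one_mul _

lemma Sfun_succ (k : ℕ) (x : ℝ) : Sfun (k + 1) x = |x| * x ^ k := by
  rcases lt_trichotomy x 0 with h | h | h
  · simp [Sfun, Real.sign_of_neg h, abs_of_neg h]; ring
  · simp [Sfun, h]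
  · simp [Sfun, Real.sign_of_pos h, abs_of_pos h]; ring

lemma Sfun_neg (k : ℕ) (x : ℝ) : Sfun k (-x) = (-1) ^ (k + 1) * Sfun k x := by
  simp only [Sfun, Real.sign_neg, neg_pow x k]
  ring

lemma Sfun_lip (k : ℕ) {M x y : ℝ} (hx : |x| ≤ M) (hy : |y| ≤ M) :
    |Sfun (k + 1) x - Sfun (k + 1) y| ≤ (M * (k * M ^ (k - 1)) + M ^ k) * |x - y| := by
  have hM : 0 ≤ M := (abs_nonneg x).trans hx
  rw [Sfun_succ, Sfun_succ]
  have e : |x| * x ^ k - |y| * y ^ k = |x| * (x ^ k - y ^ k) + (|x| - |y|) * y ^ k := by ring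
  rw [e]
  have e1 := abs_pow_sub_pow_le x y k
  have e2 := abs_abs_sub_abs_le_abs_sub x y
  have e3 : max |x| |y| ≤ M := max_le hx hy
  have e4 : (0:ℝ) ≤ max |x| |y| := (abs_nonneg x).trans (le_max_left _ _)
  calc _ ≤ |x| * |x ^ k - y ^ k| + |(|x| - |y|)| * |y| ^ k := by
        refine (abs_add_le _ _).trans ?_
        rw [abs_mul, abs_mul, abs_abs, abs_pow]
    _ ≤ M * (|x - y| * k * M ^ (k - 1)) + |x - y| * M ^ k := by
        gcongr
        exact e1.trans (by gcongr)
    _ = _ := by ring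

lemma Sfun_hasDerivAt (k : ℕ) {y : ℝ} (hy : y ≠ 0) :
    HasDerivAt (Sfun (k + 1)) ((k + 1) * Sfun k y) y := by
  have h := ((hasDerivAt_pow (k + 1) y).const_mul (Real.sign y))
  have h2 : HasDerivAt (Sfun (k + 1)) (Real.sign y * (((k + 1 : ℕ) : ℝ) * y ^ (k + 1 - 1))) y := by
    refine h.congr_of_eventuallyEq ?_
    rcases lt_or_gt_of_ne hy with h | h
    · filter_upwards [Iio_mem_nhds h] with z hz
      simp [Sfun, Real.sign_of_neg h, Real.sign_of_neg hz]
    · filter_upwards [Ioi_mem_nhds h] with z hz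
      simp [Sfun, Real.sign_of_pos h, Real.sign_of_pos hz]
  refine h2.congr_deriv ?_
  simp [Sfun]
  ring

lemma Jfun_hasDerivAt (k : ℕ) (ρ : ℝ) : HasDerivAt (Jfun (k + 1)) ((k + 1) * Jfun k ρ) ρ := by
  set M := |ρ| + 2 with hM
  have := (intervalIntegral.hasDerivAt_integral_of_dominated_loc_of_lip (μ := volume)
    (F := fun x u => Sfun (k + 1) (Real.cos u + x)) (F' := fun u => (k + 1) * Sfun k (Real.cos u + ρ))
    (x₀ := ρ) (a := 0) (b := Real.pi) (s := Metric.ball ρ 1)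
    (bound := fun _ => M * (k * M ^ (k - 1)) + M ^ k)
    (Metric.ball_mem_nhds _ one_pos) ?_ (Sfun_intervalIntegrable _ _ _ _) ?_ ?_ ?_ ?_).2
  · unfold Jfun
    rw [← intervalIntegral.integral_const_mul]
    exact this
  · exact Filter.Eventually.of_forall fun x =>
      ((measurable_Sfun (k + 1)).comp (by fun_prop)).aestronglyMeasurable
  · exact (((measurable_Sfun k).comp (by fun_prop)).const_mul _).aestronglyMeasurable
  · refine Filter.Eventually.of_forall fun u _ => ?_
    refine LipschitzOnWith.of_dist_le_mul fun x hx y hy => ?_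
    have hb : ∀ x ∈ Metric.ball ρ 1, |Real.cos u + x| ≤ M := by
      intro x hx
      rw [Metric.mem_ball, Real.dist_eq] at hx
      have e1 := Real.abs_cos_le_one u
      have e2 : |Real.cos u + x| ≤ |Real.cos u| + |x| := abs_add_le _ _
      have e3 : |x| ≤ |x - ρ| + |ρ| := by
        simpa using abs_add_le (x - ρ) ρ
      linarith
    have := Sfun_lip k (hb x hx) (hb y hy)
    have hM0 : 0 ≤ M * (k * M ^ (k - 1)) + M ^ k := by positivity
    rw [Real.dist_eq, Real.dist_eq, Real.coe_nnabs, abs_of_nonneg hM0]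
    simpa using this
  · exact intervalIntegrable_const
  · have hnull : volume {u : ℝ | u ∈ Ioc 0 Real.pi ∧ Real.cos u + ρ = 0} = 0 := by
      refine Set.Subsingleton.measure_zero ?_ _
      rintro u ⟨hu, hu'⟩ v ⟨hv, hv'⟩
      exact Real.injOn_cos ⟨hu.1.le, hu.2⟩ ⟨hv.1.le, hv.2⟩ (by linarith)
    filter_upwards [compl_mem_ae_iff.2 hnull] with u hu hu2
    rw [uIoc_of_le Real.pi_pos.le] at hu2
    have hne : Real.cos u + ρ ≠ 0 := fun h => hu ⟨hu2, h⟩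
    have h3 := (Sfun_hasDerivAt k hne).comp ρ ((hasDerivAt_id ρ).const_add (Real.cos u))
    simpa [Function.comp_def] using h3

lemma Jfun_neg (k : ℕ) (ρ : ℝ) : Jfun k (-ρ) = (-1) ^ (k + 1) * Jfun k ρ := by
  unfold Jfun
  have h := intervalIntegral.integral_comp_sub_left (a := 0) (b := Real.pi)
    (fun u => Sfun k (Real.cos u + -ρ)) Real.pi
  simp only [sub_self, sub_zero] at h
  rw [← h, ← intervalIntegral.integral_const_mul]
  congr 1
  ext u
  rw [Real.cos_pi_sub, ← Sfun_neg]
  congr 1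
  ring

lemma Jfun_zero {ρ : ℝ} (h1 : -1 ≤ ρ) (h2 : ρ ≤ 1) :
    Jfun 0 ρ = 2 * Real.arccos (-ρ) - Real.pi := by
  set A := Real.arccos (-ρ) with hA
  have hA0 : 0 ≤ A := Real.arccos_nonneg _
  have hA1 : A ≤ Real.pi := Real.arccos_le_pi _
  have hcos : Real.cos A = -ρ := Real.cos_arccos (by linarith) (by linarith)
  unfold Jfun
  rw [← intervalIntegral.integral_add_adjacent_intervals (b := A)
    (Sfun_intervalIntegrable 0 ρ _ _) (Sfun_intervalIntegrable 0 ρ _ _)]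
  have i1 : ∫ u in (0:ℝ)..A, Sfun 0 (Real.cos u + ρ) = ∫ u in (0:ℝ)..A, (1 : ℝ) := by
    refine intervalIntegral.integral_congr_ae ?_
    filter_upwards [compl_mem_ae_iff.2 (measure_singleton (μ := volume) A)] with u hu hu2
    rw [uIoc_of_le hA0] at hu2
    have hlt : u < A := lt_of_le_of_ne hu2.2 hu
    have := Real.strictAntiOn_cos ⟨hu2.1.le, hu2.2.trans hA1⟩ ⟨hA0, hA1⟩ hlt
    simp [Sfun, Real.sign_of_pos (show 0 < Real.cos u + ρ by linarith)]
  have i2 : ∫ u in A..Real.pi, Sfun 0 (Real.cos u + ρ) = ∫ u in A..Real.pi, (-1 : ℝ) := by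
    refine intervalIntegral.integral_congr_ae (Filter.Eventually.of_forall fun u hu2 => ?_)
    rw [uIoc_of_le hA1] at hu2
    have := Real.strictAntiOn_cos ⟨hA0, hA1⟩ ⟨hA0.trans hu2.1.le, hu2.2⟩ hu2.1
    simp [Sfun, Real.sign_of_neg (show Real.cos u + ρ < 0 by linarith)]
  rw [i1, i2]
  simp
  ring

lemma Jfun_zero_hasDerivAt {t : ℝ} (ht : t ∈ Ioo (0 : ℝ) 2) :
    HasDerivAt (fun t => Jfun 0 (1 - t))
      (-2 * (t ^ (-(1 / 2) : ℝ) * (2 - t) ^ (-(1 / 2) : ℝ))) t := by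
  have h1 : HasDerivAt (fun t : ℝ => 2 * Real.arccos (t - 1) - Real.pi)
      (2 * (-(1 / Real.sqrt (1 - (t - 1) ^ 2)))) t := by
    have h := Real.hasDerivAt_arccos (x := t - 1) (by linarith [ht.1]) (by linarith [ht.2])
    have h' := h.comp t ((hasDerivAt_id t).sub_const 1)
    simpa [Function.comp_def] using (h'.const_mul 2).sub_const Real.pi
  have h2 : HasDerivAt (fun t => Jfun 0 (1 - t)) (2 * (-(1 / Real.sqrt (1 - (t - 1) ^ 2)))) t := by
    refine h1.congr_of_eventuallyEq ?_
    filter_upwards [isOpen_Ioo.mem_nhds ht] with s hs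
    rw [Jfun_zero (by linarith [hs.2]) (by linarith [hs.1])]
    ring_nf
  refine h2.congr_deriv ?_
  have e : 1 - (t - 1) ^ 2 = t * (2 - t) := by ring
  have ht2 : 0 < 2 - t := by linarith [ht.2]
  rw [e, ← Real.mul_rpow ht.1.le ht2.le, Real.rpow_neg (mul_pos ht.1 ht2).le, Real.sqrt_eq_rpow]
  ring

lemma Jfun_Q (k : ℕ) : ∃ b : ℝ, 0 < b ∧
    (fun t : ℝ => Jfun k (1 - t) - (-1) ^ (k + 1) * b * t ^ ((k : ℝ) + 1 / 2)) ∈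
      Qclass (-1) ((k : ℝ) + 1 / 2) := by
  induction k with
  | zero =>
    set h : ℝ → ℝ := fun t => (2 - t) ^ (-(1 / 2) : ℝ) with hh
    have hsm : ContDiffOn ℝ (⊤ : ℕ∞) h (Iio 2) := by
      intro t ht
      have ht' : (2 : ℝ) - t ≠ 0 := by
        have : t < 2 := ht
        linarith
      exact ((contDiffAt_const.sub contDiffAt_id).rpow_const_of_ne ht').contDiffWithinAt
    have h0 : 0 < h 0 := by simp only [hh]; positivity
    refine ⟨4 * h 0, by positivity, ?_⟩
    have key := Qclass_anti (by norm_num)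
      (Qclass_smul (g := fun t => -2 * (t ^ (-(1 / 2) : ℝ) * h t - h 0 * t ^ (-(1 / 2) : ℝ)))
        (-2) (base_Q hsm) (fun t _ => rfl))
      (F := fun t : ℝ => Jfun 0 (1 - t) - (-1) ^ (0 + 1) * (4 * h 0) * t ^ (((0 : ℕ) : ℝ) + 1 / 2)) ?_
    · have e : (-(1 / 2) : ℝ) + 1 = ((0 : ℕ) : ℝ) + 1 / 2 := by norm_num
      rwa [e] at key
    · intro t ht
      have e1 := Jfun_zero_hasDerivAt ht
      have e2 := (Real.hasDerivAt_rpow_const (x := t) (p := ((0 : ℕ) : ℝ) + 1 / 2)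
        (Or.inl ht.1.ne')).const_mul ((-1) ^ (0 + 1) * (4 * h 0))
      refine (e1.fun_sub e2).congr_deriv ?_
      have e : (((0 : ℕ) : ℝ) + 1 / 2 - 1) = -(1 / 2) := by norm_num
      rw [e]
      simp only [hh]
      push_cast
      ring
  | succ k ih =>
    obtain ⟨b, hb, hQ⟩ := ih
    have hk : (0 : ℝ) < (k : ℝ) + 3 / 2 := by positivity
    refine ⟨(k + 1) * b / (k + 3 / 2), by positivity, ?_⟩
    have key := Qclass_anti (by linarith [Nat.cast_nonneg (α := ℝ) k])
      (Qclass_smul (g := fun t => -(k + 1 : ℝ) *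
        (Jfun k (1 - t) - (-1) ^ (k + 1) * b * t ^ ((k : ℝ) + 1 / 2))) _ hQ (fun t _ => rfl))
      (F := fun t : ℝ => Jfun (k + 1) (1 - t) -
        (-1) ^ (k + 1 + 1) * ((k + 1) * b / (k + 3 / 2)) * t ^ (((k + 1 : ℕ) : ℝ) + 1 / 2)) ?_
    · have e : (k : ℝ) + 1 / 2 + 1 = ((k + 1 : ℕ) : ℝ) + 1 / 2 := by push_cast; ring
      rwa [e] at key
    · intro t ht
      have e1 := (Jfun_hasDerivAt k (1 - t)).comp t ((hasDerivAt_id t).const_sub 1)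
      have e2 := (Real.hasDerivAt_rpow_const (x := t) (p := ((k + 1 : ℕ) : ℝ) + 1 / 2)
        (Or.inl ht.1.ne')).const_mul ((-1) ^ (k + 1 + 1) * ((k + 1) * b / (k + 3 / 2)))
      refine (e1.fun_sub e2).congr_deriv ?_
      have e : (((k + 1 : ℕ) : ℝ) + 1 / 2 - 1) = k + 1 / 2 := by push_cast; ring
      have e' : (((k + 1 : ℕ) : ℝ) + 1 / 2) = k + 3 / 2 := by push_cast; ring
      rw [e, e']
      field_simp
      ring

lemma rsign_mul (x y : ℝ) : Real.sign (x * y) = Real.sign x * Real.sign y := by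
  rcases lt_trichotomy x 0 with hx | hx | hx <;> rcases lt_trichotomy y 0 with hy | hy | hy
  · simp [Real.sign_of_neg hx, Real.sign_of_neg hy, Real.sign_of_pos (mul_pos_of_neg_of_neg hx hy)]
  · simp [hy]
  · simp [Real.sign_of_neg hx, Real.sign_of_pos hy, Real.sign_of_neg (mul_neg_of_neg_of_pos hx hy)]
  · simp [hx]
  · simp [hx]
  · simp [hx]
  · simp [Real.sign_of_pos hx, Real.sign_of_neg hy, Real.sign_of_neg (mul_neg_of_pos_of_neg hx hy)]
  · simp [hy]
  · simp [Real.sign_of_pos hx, Real.sign_of_pos hy, Real.sign_of_pos (mul_pos hx hy)]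

lemma Sfun_mul (k : ℕ) (x y : ℝ) : Sfun k (x * y) = Sfun k x * Sfun k y := by
  simp only [Sfun, rsign_mul, mul_pow]
  ring

lemma angle_integral (k : ℕ) (ρ : ℝ) :
    ∫ θ in Ioo (-Real.pi) Real.pi, Sfun k (Real.cos (2 * θ) + ρ) = 2 * Jfun k ρ := by
  rw [← integral_Ioc_eq_integral_Ioo,
    ← intervalIntegral.integral_of_le (by linarith [Real.pi_pos])]
  have h1 := intervalIntegral.integral_comp_mul_left (a := -Real.pi) (b := Real.pi)
    (fun u => Sfun k (Real.cos u + ρ)) (c := 2) (by norm_num)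
  rw [h1]
  set g : ℝ → ℝ := fun u => Sfun k (Real.cos u + ρ) with hg
  have hi : ∀ a b, IntervalIntegrable g volume a b := Sfun_intervalIntegrable k ρ
  have e1 : ∫ u in Real.pi..(2 * Real.pi), g u = Jfun k ρ := by
    have := intervalIntegral.integral_comp_sub_left (a := 0) (b := Real.pi) g (2 * Real.pi)
    rw [show 2 * Real.pi - Real.pi = Real.pi by ring, sub_zero] at this
    rw [← this]
    simp only [hg, Real.cos_two_pi_sub]
    rfl
  have e2 : ∫ u in (0 : ℝ)..(2 * Real.pi), g u = 2 * Jfun k ρ := by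
    rw [← intervalIntegral.integral_add_adjacent_intervals (hi 0 Real.pi) (hi _ _), e1]
    have : ∫ u in (0 : ℝ)..Real.pi, g u = Jfun k ρ := rfl
    rw [this]
    ring
  have e3 : ∫ u in (2 * -Real.pi)..(0 : ℝ), g u = 2 * Jfun k ρ := by
    have := intervalIntegral.integral_comp_neg (a := 0) (b := 2 * Real.pi) g
    rw [neg_zero, show -(2 * Real.pi) = 2 * -Real.pi by ring] at this
    rw [← this, ← e2]
    simp only [hg, Real.cos_neg]
  rw [← intervalIntegral.integral_add_adjacent_intervals (hi _ 0) (hi _ _), e2, e3]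
  simp
  ring

lemma radial_pos (k : ℕ) (c : ℝ) (hc : 0 < c) :
    0 < ∫ r in Ioi (0 : ℝ), r * (c * Real.exp (-(r ^ 2) / 2) * (r ^ 2 / 2) ^ k) := by
  have h : ∫ r in Ioi (0 : ℝ), r * (c * Real.exp (-(r ^ 2) / 2) * (r ^ 2 / 2) ^ k)
      = (c / 2 ^ k) * ∫ r in Ioi (0 : ℝ),
        r ^ ((2 * k + 1 : ℕ) : ℝ) * Real.exp (-(1 / 2) * r ^ (2 : ℝ)) := by
    rw [← integral_const_mul]
    refine setIntegral_congr_fun measurableSet_Ioi fun r _ => ?_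
    simp only [Real.rpow_natCast, Real.rpow_two]
    rw [show -(r ^ 2) / 2 = -(1 / 2) * r ^ 2 by ring]
    rw [div_pow]
    field_simp
    ring
  have hk : (0 : ℝ) ≤ ((2 * k + 1 : ℕ) : ℝ) := Nat.cast_nonneg _
  rw [h, integral_rpow_mul_exp_neg_mul_rpow (by norm_num) (by linarith) (by norm_num)]
  have := Real.Gamma_pos_of_pos (s := (((2 * k + 1 : ℕ) : ℝ) + 1) / 2) (by positivity)
  positivity

lemma dualAct_eq (k : ℕ) : ∃ C : ℝ, 0 < C ∧ ∀ ρ : ℝ, -1 ≤ ρ → ρ ≤ 1 →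
    dualAct (refAct k) ρ = C * Jfun k ρ := by
  set c : ℝ := (Real.sqrt (2 * Real.pi))⁻¹ ^ 2 / (2 * k.factorial) ^ 2 with hc
  have hc0 : 0 < c := by
    have := Real.pi_pos
    positivity
  refine ⟨2 * ∫ r in Ioi (0 : ℝ), r * (c * Real.exp (-(r ^ 2) / 2) * (r ^ 2 / 2) ^ k),
    mul_pos two_pos (radial_pos k c hc0), ?_⟩
  intro ρ h1 h2
  have hμ : stdGaussian.prod stdGaussian = (volume : Measure (ℝ × ℝ)).withDensity
      (fun z => gaussianPDF 0 1 z.1 * gaussianPDF 0 1 z.2) := by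
    unfold _root_.stdGaussian
    rw [gaussianReal_of_var_ne_zero 0 one_ne_zero,
      prod_withDensity (measurable_gaussianPDF _ _) (measurable_gaussianPDF _ _)]
    rfl
  unfold dualAct
  rw [hμ, integral_withDensity_eq_integral_toReal_smul]
  rotate_left
  · exact ((measurable_gaussianPDF _ _).comp measurable_fst).mul
      ((measurable_gaussianPDF _ _).comp measurable_snd)
  · exact Filter.Eventually.of_forall fun z => ENNReal.mul_lt_top gaussianPDF_lt_top gaussianPDF_lt_top
  rw [← integral_comp_polarCoord_symm]
  have hJ := angle_integral k ρ
  rw [show ∀ A : ℝ, 2 * A * Jfun k ρ = A * (2 * Jfun k ρ) from fun A => by ring, ← hJ,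
    ← setIntegral_prod_mul (μ := volume) (ν := volume), polarCoord_target]
  refine setIntegral_congr_fun (measurableSet_Ioi.prod measurableSet_Ioo) ?_
  rintro ⟨r, θ⟩ ⟨hr, hθ⟩
  have hr0 : 0 < r := hr
  simp only [polarCoord_symm_apply, ENNReal.toReal_mul, toReal_gaussianPDF, smul_eq_mul]
  set x := r * Real.cos θ with hx
  set y := r * Real.sin θ with hy
  have hprod : (Real.sqrt ((1 + ρ) / 2) * x + Real.sqrt ((1 - ρ) / 2) * y) *
      (Real.sqrt ((1 + ρ) / 2) * x - Real.sqrt ((1 - ρ) / 2) * y)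
      = (r ^ 2 / 2) * (Real.cos (2 * θ) + ρ) := by
    have s1 := Real.sq_sqrt (show 0 ≤ (1 + ρ) / 2 by linarith)
    have s2 := Real.sq_sqrt (show 0 ≤ (1 - ρ) / 2 by linarith)
    have s3 := Real.sin_sq_add_cos_sq θ
    calc _ = (Real.sqrt ((1 + ρ) / 2)) ^ 2 * x ^ 2 - (Real.sqrt ((1 - ρ) / 2)) ^ 2 * y ^ 2 := by ring
      _ = (r ^ 2 / 2) * ((1 + ρ) * Real.cos θ ^ 2 - (1 - ρ) * Real.sin θ ^ 2) := by
        rw [s1, s2, hx, hy]; ring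
      _ = _ := by
        rw [Real.cos_two_mul, show Real.sin θ ^ 2 = 1 - Real.cos θ ^ 2 by linarith]; ring
  have hS : ∀ z, refAct k z = Sfun k z / (2 * k.factorial) := fun z => rfl
  have hSr : Sfun k (r ^ 2 / 2) = (r ^ 2 / 2) ^ k := by
    simp [Sfun, Real.sign_of_pos (show 0 < r ^ 2 / 2 by positivity)]
  have hpdf : gaussianPDFReal 0 1 x * gaussianPDFReal 0 1 y
      = (Real.sqrt (2 * Real.pi))⁻¹ ^ 2 * Real.exp (-(r ^ 2) / 2) := by
    simp only [gaussianPDFReal, NNReal.coe_one, mul_one, sub_zero]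
    rw [mul_mul_mul_comm, ← Real.exp_add, ← sq]
    congr 2
    rw [hx, hy]
    linear_combination (-(r ^ 2) / 2) * Real.sin_sq_add_cos_sq θ
  have hSS : refAct k (Real.sqrt ((1 + ρ) / 2) * x + Real.sqrt ((1 - ρ) / 2) * y) *
      refAct k (Real.sqrt ((1 + ρ) / 2) * x - Real.sqrt ((1 - ρ) / 2) * y)
      = (r ^ 2 / 2) ^ k * Sfun k (Real.cos (2 * θ) + ρ) / (2 * k.factorial) ^ 2 := by
    rw [hS, hS, div_mul_div_comm, ← Sfun_mul, hprod, Sfun_mul, hSr]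
    congr 1
    ring
  rw [hpdf, hSS, hc]
  ring

/-- boundary behavior of the dual reference activations: for every `k` there is
`b_k > 0` with `ŝ_k(τ(1−t)) = (−τ)^{k+1} b_k t^{k+1/2} + Q_{−1,k+1/2}(t)`. -/
theorem dualAct_refAct_boundary (k : ℕ) :
    ∃ b : ℝ, 0 < b ∧ ∀ τ : ℝ, (τ = 1 ∨ τ = -1) →
      (fun t : ℝ => dualAct (refAct k) (τ * (1 - t))
          - (-τ) ^ (k + 1) * b * t ^ ((k : ℝ) + 1 / 2))
        ∈ Qclass (-1) ((k : ℝ) + 1 / 2) := by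
  obtain ⟨b, hb, hQ⟩ := Jfun_Q k
  obtain ⟨C, hC, hd⟩ := dualAct_eq k
  refine ⟨C * b, mul_pos hC hb, ?_⟩
  rintro τ (rfl | rfl)
  · refine Qclass_smul C hQ fun t ht => ?_
    rw [hd _ (by linarith [ht.2]) (by linarith [ht.1]), one_mul]
    ring
  · refine Qclass_smul (C * (-1) ^ (k + 1)) hQ fun t ht => ?_
    rw [hd _ (by linarith [ht.1]) (by linarith [ht.2]), neg_one_mul, Jfun_neg, neg_neg, one_pow]
    have e : ((-1 : ℝ)) ^ (k + 1) * (-1) ^ (k + 1) = 1 := by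
      rw [← mul_pow]; simp
    linear_combination (C * b * t ^ ((k : ℝ) + 1 / 2)) * e
end
end

section
/- Let φ : ℝ → ℝ satisfy the activation assumption and let m ∈ ℕ₀ be such that Δ_k(φ) = 0 for all k < m. Then there exists a constant b_m > 0 depending only on m such that for each τ ∈ {−1, 1}, the function t ↦ φ̂(τ(1−t)) − Δ_m(φ)²·(−τ)^{m+1}·b_m·t^{m+1/2}, defined on (0,2), belongs to the class Q_{−1, m+1/2}. -/
open MeasureTheory ProbabilityTheory Filter Set

noncomputable section

/-- The activation assumption: `φ` is smooth with polynomially bounded derivatives away from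
zero (on `(0,∞)` and on `(−∞,0)`), `φ(0)` is the average of the one-sided limits at `0`,
and `φ` is not the zero function. -/
def IsActivation (φ : ℝ → ℝ) : Prop :=
  ContDiffOn ℝ (⊤ : ℕ∞) φ (Set.Ioi (0 : ℝ)) ∧
  ContDiffOn ℝ (⊤ : ℕ∞) φ (Set.Iio (0 : ℝ)) ∧
  (∀ m : ℕ, ∃ a b q : ℝ, 0 < a ∧ 0 < b ∧ 0 < q ∧
    ∀ x : ℝ, 0 < x →
      |iteratedDerivWithin m φ (Set.Ioi (0 : ℝ)) x| ≤ a * |x| ^ q + b) ∧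
  (∀ m : ℕ, ∃ a b q : ℝ, 0 < a ∧ 0 < b ∧ 0 < q ∧
    ∀ x : ℝ, x < 0 →
      |iteratedDerivWithin m φ (Set.Iio (0 : ℝ)) x| ≤ a * |x| ^ q + b) ∧
  φ 0 = (limUnder (nhdsWithin 0 (Set.Ioi (0 : ℝ))) φ +
         limUnder (nhdsWithin 0 (Set.Iio (0 : ℝ))) φ) / 2 ∧
  φ ≠ 0

/-- `Δ_k(φ) = φ^{(k)}(0+) − φ^{(k)}(0−)`, the jump of the `k`-th derivative at zero. -/
def deltaK (φ : ℝ → ℝ) (k : ℕ) : ℝ :=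
  limUnder (nhdsWithin 0 (Set.Ioi (0 : ℝ)))
      (iteratedDerivWithin k φ (Set.Ioi (0 : ℝ))) -
  limUnder (nhdsWithin 0 (Set.Iio (0 : ℝ)))
      (iteratedDerivWithin k φ (Set.Iio (0 : ℝ)))

open scoped Topology

/-! ### Remainder classes with derivative control -/

/-- Bounds on the first `j` derivatives: the `i`-th derivative is `O(t^{γ-i})`. -/
def RB : ℕ → ℝ → (ℝ → ℝ) → Prop
  | 0, γ, f => ∃ C : ℝ, ∀ t ∈ Ioo (0:ℝ) 1, |f t| ≤ C * t ^ γ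
  | (j+1), γ, f => (∃ C : ℝ, ∀ t ∈ Ioo (0:ℝ) 1, |f t| ≤ C * t ^ γ) ∧
      ∃ f' : ℝ → ℝ, (∀ t ∈ Ioo (0:ℝ) 2, HasDerivAt f (f' t) t) ∧ RB j (γ - 1) f'

lemma RB.bound {j : ℕ} {γ : ℝ} {f : ℝ → ℝ} (h : RB j γ f) :
    ∃ C : ℝ, ∀ t ∈ Ioo (0:ℝ) 1, |f t| ≤ C * t ^ γ := by
  cases j with
  | zero => exact h
  | succ j => exact h.1

lemma RB.pred {j : ℕ} : ∀ {γ : ℝ} {f : ℝ → ℝ}, RB (j+1) γ f → RB j γ f := by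
  induction j with
  | zero => intro γ f h; exact h.1
  | succ j ih =>
    rintro γ f ⟨h1, f', h2, h3⟩
    exact ⟨h1, f', h2, ih h3⟩

lemma bound_mono {γ γ' : ℝ} (hγ : γ' ≤ γ) {f : ℝ → ℝ}
    (h : ∃ C : ℝ, ∀ t ∈ Ioo (0:ℝ) 1, |f t| ≤ C * t ^ γ) :
    ∃ C : ℝ, ∀ t ∈ Ioo (0:ℝ) 1, |f t| ≤ C * t ^ γ' := by
  obtain ⟨C, hC⟩ := h
  refine ⟨|C|, fun t ht => (hC t ht).trans ?_⟩
  have h1 : t ^ γ ≤ t ^ γ' := Real.rpow_le_rpow_of_exponent_ge ht.1 ht.2.le hγ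
  have h2 : 0 ≤ t ^ γ := Real.rpow_nonneg ht.1.le _
  calc C * t ^ γ ≤ |C| * t ^ γ := by gcongr; exact le_abs_self C
    _ ≤ |C| * t ^ γ' := by gcongr

lemma RB.mono {j : ℕ} : ∀ {γ γ' : ℝ} {f : ℝ → ℝ}, γ' ≤ γ → RB j γ f → RB j γ' f := by
  induction j with
  | zero => intro γ γ' f hγ h; exact bound_mono hγ h
  | succ j ih =>
    rintro γ γ' f hγ ⟨h1, f', h2, h3⟩
    exact ⟨bound_mono hγ h1, f', h2, ih (by linarith) h3⟩

lemma RB.congr {j : ℕ} {γ : ℝ} {f g : ℝ → ℝ} (hfg : ∀ t ∈ Ioo (0:ℝ) 2, f t = g t)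
    (h : RB j γ f) : RB j γ g := by
  have key : (∃ C : ℝ, ∀ t ∈ Ioo (0:ℝ) 1, |f t| ≤ C * t ^ γ) →
      ∃ C : ℝ, ∀ t ∈ Ioo (0:ℝ) 1, |g t| ≤ C * t ^ γ := by
    rintro ⟨C, hC⟩
    refine ⟨C, fun t ht => ?_⟩
    rw [← hfg t ⟨ht.1, by linarith [ht.2]⟩]; exact hC t ht
  cases j with
  | zero => exact key h
  | succ j =>
    obtain ⟨h1, f', h2, h3⟩ := h
    refine ⟨key h1, f', fun t ht => (h2 t ht).congr_of_eventuallyEq ?_, h3⟩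
    filter_upwards [isOpen_Ioo.mem_nhds ht] with u hu using (hfg u hu).symm

lemma RB.add {j : ℕ} : ∀ {γ : ℝ} {f g : ℝ → ℝ}, RB j γ f → RB j γ g →
    RB j γ (fun t => f t + g t) := by
  have key : ∀ {γ : ℝ} {f g : ℝ → ℝ}, (∃ C : ℝ, ∀ t ∈ Ioo (0:ℝ) 1, |f t| ≤ C * t ^ γ) →
      (∃ C : ℝ, ∀ t ∈ Ioo (0:ℝ) 1, |g t| ≤ C * t ^ γ) →
      ∃ C : ℝ, ∀ t ∈ Ioo (0:ℝ) 1, |f t + g t| ≤ C * t ^ γ := by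
    rintro γ f g ⟨C, hC⟩ ⟨D, hD⟩
    refine ⟨C + D, fun t ht => (abs_add_le _ _).trans ?_⟩
    rw [add_mul]; exact add_le_add (hC t ht) (hD t ht)
  induction j with
  | zero => intro γ f g hf hg; exact key hf hg
  | succ j ih =>
    rintro γ f g ⟨h1, f', h2, h3⟩ ⟨k1, g', k2, k3⟩
    exact ⟨key h1 k1, _, fun t ht => (h2 t ht).add (k2 t ht), ih h3 k3⟩

lemma RB.mul {j : ℕ} : ∀ {γ δ : ℝ} {f g : ℝ → ℝ}, RB j γ f → RB j δ g →
    RB j (γ + δ) (fun t => f t * g t) := by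
  have key : ∀ {γ δ : ℝ} {f g : ℝ → ℝ}, (∃ C : ℝ, ∀ t ∈ Ioo (0:ℝ) 1, |f t| ≤ C * t ^ γ) →
      (∃ C : ℝ, ∀ t ∈ Ioo (0:ℝ) 1, |g t| ≤ C * t ^ δ) →
      ∃ C : ℝ, ∀ t ∈ Ioo (0:ℝ) 1, |f t * g t| ≤ C * t ^ (γ + δ) := by
    rintro γ δ f g ⟨C, hC⟩ ⟨D, hD⟩
    refine ⟨C * D, fun t ht => ?_⟩
    rw [abs_mul, Real.rpow_add ht.1, show C * D * (t ^ γ * t ^ δ) = (C * t ^ γ) * (D * t ^ δ) by ring]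
    exact mul_le_mul (hC t ht) (hD t ht) (abs_nonneg _) ((abs_nonneg _).trans (hC t ht))
  induction j with
  | zero => intro γ δ f g hf hg; exact key hf hg
  | succ j ih =>
    intro γ δ f g hf hg
    have hf' := hf.pred
    have hg' := hg.pred
    obtain ⟨h1, f', h2, h3⟩ := hf
    obtain ⟨k1, g', k2, k3⟩ := hg
    refine ⟨key h1 k1, _, fun t ht => (h2 t ht).mul (k2 t ht), RB.add ?_ ?_⟩
    · have := ih h3 hg'
      rwa [show γ - 1 + δ = γ + δ - 1 by ring] at this
    · have := ih hf' k3
      rwa [show γ + (δ - 1) = γ + δ - 1 by ring] at this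

lemma RB.rpow (j : ℕ) : ∀ (a c : ℝ), RB j a (fun t => c * t ^ a) := by
  have key : ∀ a c : ℝ, ∃ C : ℝ, ∀ t ∈ Ioo (0:ℝ) 1, |c * t ^ a| ≤ C * t ^ a := by
    intro a c
    refine ⟨|c|, fun t ht => ?_⟩
    rw [abs_mul, abs_of_nonneg (Real.rpow_nonneg ht.1.le _)]
  induction j with
  | zero => exact key
  | succ j ih =>
    intro a c
    refine ⟨key a c, fun t => (c * a) * t ^ (a - 1), fun t ht => ?_, ih _ _⟩
    have := (Real.hasDerivAt_rpow_const (x := t) (p := a) (Or.inl ht.1.ne')).const_mul c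
    exact this.congr_deriv (by ring)

lemma RB.const (j : ℕ) (c : ℝ) : RB j 0 (fun _ => c) :=
  (RB.rpow j 0 c).congr (fun t _ => by simp)

lemma RB.zero (j : ℕ) (γ : ℝ) : RB j γ (fun _ => 0) :=
  (RB.rpow j γ 0).congr (fun t _ => by simp)

lemma RB.const_mul {j : ℕ} {γ : ℝ} {f : ℝ → ℝ} (c : ℝ) (h : RB j γ f) :
    RB j γ (fun t => c * f t) := by
  have := (RB.const j c).mul h
  rwa [zero_add] at this

lemma RB.spec {j : ℕ} : ∀ {γ : ℝ} {f : ℝ → ℝ}, RB j γ f →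
    ∃ C : ℝ, ∀ t ∈ Ioo (0:ℝ) 1, |iteratedDerivWithin j f (Ioo (0:ℝ) 2) t| ≤ C * t ^ (γ - j) := by
  induction j with
  | zero =>
    rintro γ f ⟨C, hC⟩
    exact ⟨C, fun t ht => by simpa using hC t ht⟩
  | succ j ih =>
    rintro γ f ⟨h1, f', h2, h3⟩
    obtain ⟨C, hC⟩ := ih h3
    refine ⟨C, fun t ht => ?_⟩
    have ht2 : t ∈ Ioo (0:ℝ) 2 := ⟨ht.1, by linarith [ht.2]⟩
    have hE : EqOn (derivWithin f (Ioo (0:ℝ) 2)) f' (Ioo (0:ℝ) 2) := fun u hu =>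
      (h2 u hu).hasDerivWithinAt.derivWithin (isOpen_Ioo.uniqueDiffOn u hu)
    rw [iteratedDerivWithin_succ', iteratedDerivWithin_congr hE ht2]
    have := hC t ht
    rwa [show γ - ((j + 1 : ℕ) : ℝ) = γ - 1 - j by push_cast; ring]

lemma RB.contDiffOn {j : ℕ} : ∀ {γ : ℝ} {f : ℝ → ℝ}, RB (j+1) γ f →
    ContDiffOn ℝ j f (Ioo (0:ℝ) 2) := by
  induction j with
  | zero =>
    rintro γ f ⟨h1, f', h2, h3⟩
    simp only [Nat.cast_zero, contDiffOn_zero]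
    exact fun t ht => (h2 t ht).continuousAt.continuousWithinAt
  | succ j ih =>
    rintro γ f ⟨h1, f', h2, h3⟩
    have hE : EqOn (derivWithin f (Ioo (0:ℝ) 2)) f' (Ioo (0:ℝ) 2) := fun u hu =>
      (h2 u hu).hasDerivWithinAt.derivWithin (isOpen_Ioo.uniqueDiffOn u hu)
    push_cast
    rw [contDiffOn_succ_iff_derivWithin isOpen_Ioo.uniqueDiffOn]
    refine ⟨fun t ht => (h2 t ht).differentiableAt.differentiableWithinAt, by simp, ?_⟩
    exact (ih h3).congr hE

lemma RB.mem_Rclass {γ : ℝ} {f : ℝ → ℝ} (h : ∀ j, RB j γ f) : f ∈ Rclass γ := by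
  refine ⟨?_, fun j => ?_⟩
  · rw [contDiffOn_infty]
    exact fun n => (h (n+1)).contDiffOn
  · obtain ⟨C, hC⟩ := (h j).spec
    refine ⟨C, 1, one_pos, fun t ht => hC t ⟨ht.1, ht.2.trans_le (min_le_left _ _)⟩⟩

/-! ### Generalized polynomials, as lists of (coefficient, exponent) -/

/-- admissible exponents -/
def Allowed (α β e : ℝ) : Prop :=
  ((∃ z : ℤ, e = (z : ℝ)) → α < e) ∧ ((¬ ∃ z : ℤ, e = (z : ℝ)) → β < e)

/-- generalized polynomial attached to a list -/
def lsum (L : List (ℝ × ℝ)) (t : ℝ) : ℝ := (L.map (fun x => x.1 * t ^ x.2)).sum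

@[simp] lemma lsum_nil (t : ℝ) : lsum [] t = 0 := rfl
@[simp] lemma lsum_cons (x : ℝ × ℝ) (L : List (ℝ × ℝ)) (t : ℝ) :
    lsum (x :: L) t = x.1 * t ^ x.2 + lsum L t := by simp [lsum]
lemma lsum_append (L M : List (ℝ × ℝ)) (t : ℝ) : lsum (L ++ M) t = lsum L t + lsum M t := by
  simp [lsum]

lemma lsum_mul_rpow (L : List (ℝ × ℝ)) (c a : ℝ) {t : ℝ} (ht : 0 < t) :
    lsum (L.map (fun x => (c * x.1, x.2 + a))) t = c * t ^ a * lsum L t := by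
  induction L with
  | nil => simp
  | cons x L ih =>
    simp only [List.map_cons, lsum_cons, ih, Real.rpow_add ht]; ring

lemma lsum_hasDerivAt (L : List (ℝ × ℝ)) (hL : ∀ x ∈ L, x.2 + 1 ≠ 0) {t : ℝ} (ht : 0 < t) :
    HasDerivAt (lsum (L.map (fun x => (x.1 / (x.2 + 1), x.2 + 1)))) (lsum L t) t := by
  induction L with
  | nil => simpa [funext_iff] using! hasDerivAt_const t (0:ℝ)
  | cons x L ih =>
    have h1 := ih (fun y hy => hL y (List.mem_cons_of_mem _ hy))
    have hx := hL x (List.mem_cons_self)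
    have h2 := (Real.hasDerivAt_rpow_const (x := t) (p := x.2 + 1) (Or.inl ht.ne')).const_mul
      (x.1 / (x.2 + 1))
    have h3 := h2.add h1
    have e : lsum ((x :: L).map (fun x => (x.1 / (x.2 + 1), x.2 + 1))) =
        (fun y => x.1 / (x.2 + 1) * y ^ (x.2 + 1)) +
        lsum (L.map (fun x => (x.1 / (x.2 + 1), x.2 + 1))) := by
      ext y; simp
    rw [e, lsum_cons]
    refine h3.congr_deriv ?_
    rw [add_sub_cancel_right]; field_simp

lemma lsum_tendsto (L : List (ℝ × ℝ)) (hL : ∀ x ∈ L, 0 < x.2) :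
    Tendsto (lsum L) (𝓝[>] 0) (𝓝 0) := by
  induction L with
  | nil => exact tendsto_const_nhds.congr (fun t => (lsum_nil t).symm)
  | cons x L ih =>
    have h1 := ih (fun y hy => hL y (List.mem_cons_of_mem _ hy))
    have hx := hL x (List.mem_cons_self)
    have h2 : Tendsto (fun t : ℝ => x.1 * t ^ x.2) (𝓝[>] 0) (𝓝 0) := by
      have : ContinuousAt (fun t : ℝ => x.1 * t ^ x.2) 0 :=
        (Real.continuousAt_rpow_const _ _ (Or.inr hx.le)).const_mul _ 
      have := this.tendsto.mono_left (nhdsWithin_le_nhds (s := Ioi 0))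
      simpa [Real.zero_rpow hx.ne'] using! this
    have := h2.add h1
    simpa [lsum] using! this

lemma lsum_RB (L : List (ℝ × ℝ)) (a : ℝ) (hL : ∀ x ∈ L, a ≤ x.2) (j : ℕ) : RB j a (lsum L) := by
  induction L with
  | nil => exact (RB.zero j a).congr (fun t _ => by simp)
  | cons x L ih =>
    have h1 := ih (fun y hy => hL y (List.mem_cons_of_mem _ hy))
    have hx := hL x (List.mem_cons_self)
    exact (((RB.rpow j x.2 x.1).mono hx).add h1).congr (fun t _ => by simp)

lemma lsum_mem_Pclass {α β : ℝ} (L : List (ℝ × ℝ)) (hL : ∀ x ∈ L, Allowed α β x.2) :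
    lsum L ∈ Pclass α β := by
  refine ⟨L.length, fun i => (L.get i).1, fun i => (L.get i).2, ?_, ?_, ?_⟩
  · exact fun i => (hL _ (List.get_mem L i)).1
  · exact fun i => (hL _ (List.get_mem L i)).2
  · intro t _
    rw [lsum, ← List.sum_ofFn]
    congr 1
    apply List.ext_get <;> simp

/-- `f ∈ P_{α,β} + R_γ` -/
def PR (α β γ : ℝ) (f : ℝ → ℝ) : Prop :=
  ∃ L : List (ℝ × ℝ), (∀ x ∈ L, Allowed α β x.2) ∧ ∃ r : ℝ → ℝ, (∀ j, RB j γ r) ∧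
    ∀ t ∈ Ioo (0:ℝ) 2, f t = lsum L t + r t

lemma PR.mem_Qclass {α β : ℝ} {f : ℝ → ℝ} (h : ∀ γ, PR α β γ f) : f ∈ Qclass α β := by
  intro γ
  obtain ⟨L, hL, r, hr, h⟩ := h γ
  exact ⟨lsum L, lsum_mem_Pclass L hL, r, RB.mem_Rclass hr, h⟩

lemma PR.congr {α β γ : ℝ} {f g : ℝ → ℝ} (h : PR α β γ f)
    (hfg : ∀ t ∈ Ioo (0:ℝ) 2, f t = g t) : PR α β γ g := by
  obtain ⟨L, hL, r, hr, h⟩ := h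
  exact ⟨L, hL, r, hr, fun t ht => by rw [← hfg t ht, h t ht]⟩

lemma PR.add {α β γ : ℝ} {f g : ℝ → ℝ} (hf : PR α β γ f) (hg : PR α β γ g) :
    PR α β γ (fun t => f t + g t) := by
  obtain ⟨L, hL, r, hr, h⟩ := hf
  obtain ⟨M, hM, s, hs, k⟩ := hg
  refine ⟨L ++ M, fun x hx => ?_, _, fun j => (hr j).add (hs j), fun t ht => ?_⟩
  · rcases List.mem_append.1 hx with hx | hx
    · exact hL x hx
    · exact hM x hx
  · simp only [lsum_append, h t ht, k t ht]; ring

lemma Allowed.mono {α β α' β' e : ℝ} (hα : α' ≤ α) (hβ : β' ≤ β) (h : Allowed α β e) :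
    Allowed α' β' e := ⟨fun z => hα.trans_lt (h.1 z), fun z => hβ.trans_lt (h.2 z)⟩

lemma PR.mono {α β γ α' β' γ' : ℝ} {f : ℝ → ℝ} (hα : α' ≤ α) (hβ : β' ≤ β) (hγ : γ' ≤ γ)
    (h : PR α β γ f) : PR α' β' γ' f := by
  obtain ⟨L, hL, r, hr, h⟩ := h
  exact ⟨L, fun x hx => (hL x hx).mono hα hβ, r, fun j => (hr j).mono hγ, h⟩

lemma PR.mul_rpow {α β γ α' β' : ℝ} {f : ℝ → ℝ} (h : PR α β γ f) (c a : ℝ)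
    (hA : ∀ e, Allowed α β e → Allowed α' β' (e + a)) :
    PR α' β' (γ + a) (fun t => c * t ^ a * f t) := by
  obtain ⟨L, hL, r, hr, h⟩ := h
  refine ⟨L.map (fun x => (c * x.1, x.2 + a)), fun x hx => ?_, _, fun j =>
    (by have := (RB.rpow j a c).mul (hr j); rwa [add_comm] at this), fun t ht => ?_⟩
  · obtain ⟨y, hy, rfl⟩ := List.mem_map.1 hx
    exact hA _ (hL y hy)
  · simp only [lsum_mul_rpow _ _ _ ht.1, h t ht]; ring

lemma PR.const_mul {α β γ : ℝ} {f : ℝ → ℝ} (h : PR α β γ f) (c : ℝ) :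
    PR α β γ (fun t => c * f t) := by
  have := (h.mul_rpow (α' := α) (β' := β) c 0 (fun e he => by simpa using he))
  rw [add_zero] at this
  exact this.congr (fun t _ => by simp)

lemma Allowed.add_one {α β e : ℝ} (h : Allowed α β e) : Allowed (α+1) (β+1) (e+1) := by
  constructor
  · rintro ⟨z, hz⟩
    have := h.1 ⟨z - 1, by push_cast; linarith⟩
    linarith
  · intro hz
    have := h.2 (fun ⟨z, hz'⟩ => hz ⟨z + 1, by push_cast; linarith⟩)
    linarith

lemma PR.linear_mul {α β γ : ℝ} {f : ℝ → ℝ} (h : PR α β γ f) (a b : ℝ) :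
    PR α β γ (fun t => (a + b * t) * f t) := by
  have h1 := h.const_mul a
  have h2 := (h.mul_rpow b 1 (fun e he => he.add_one)).mono
    (show α ≤ α + 1 by linarith) (show β ≤ β + 1 by linarith) (show γ ≤ γ + 1 by linarith)
  exact (h1.add h2).congr (fun t _ => by simp; ring)

lemma PR.monomial {α β e : ℝ} (γ c : ℝ) (h : Allowed α β e) : PR α β γ (fun t => c * t ^ e) :=
  ⟨[(c, e)], by simpa using h, _, fun j => RB.zero j γ, fun t _ => by simp⟩

lemma PR.const (β γ c : ℝ) : PR (-1) β γ (fun _ => c) := by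
  have : Allowed (-1) β 0 := ⟨fun _ => by norm_num, fun h => absurd ⟨0, by simp⟩ h⟩
  exact (PR.monomial γ c this).congr (fun t _ => by simp)

lemma PR.zero (α β γ : ℝ) : PR α β γ (fun _ => 0) :=
  ⟨[], by simp, _, fun j => RB.zero j γ, fun t _ => by simp⟩

/-- a function with integrable power bound on the derivative has a limit at `0+` -/
lemma exists_limit {g r : ℝ → ℝ} {C γ : ℝ} (hγ : -1 < γ)
    (hd : ∀ t ∈ Ioo (0:ℝ) 1, HasDerivAt g (r t) t) (hb : ∀ t ∈ Ioo (0:ℝ) 1, |r t| ≤ C * t ^ γ) :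
    ∃ c, Tendsto g (𝓝[>] 0) (𝓝 c) ∧
      ∀ t ∈ Ioo (0:ℝ) 1, |g t - c| ≤ C / (γ + 1) * t ^ (γ + 1) := by
  have hg1 : γ + 1 ≠ 0 := by linarith
  have hg2 : 0 < γ + 1 := by linarith
  set K := C / (γ + 1) with hK
  have hpow : ∀ t ∈ Ioo (0:ℝ) 1, HasDerivAt (fun t : ℝ => K * t ^ (γ + 1)) (C * t ^ γ) t := by
    intro t ht
    have := (Real.hasDerivAt_rpow_const (x := t) (p := γ + 1) (Or.inl ht.1.ne')).const_mul K
    refine this.congr_deriv ?_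
    rw [hK, add_sub_cancel_right]; field_simp
  have mono : ∀ (u u' : ℝ → ℝ), (∀ t ∈ Ioo (0:ℝ) 1, HasDerivAt u (u' t) t) →
      (∀ t ∈ Ioo (0:ℝ) 1, 0 ≤ u' t) → MonotoneOn u (Ioo (0:ℝ) 1) := by
    intro u u' h1 h2
    refine monotoneOn_of_deriv_nonneg (convex_Ioo 0 1)
      (fun t ht => (h1 t ht).continuousAt.continuousWithinAt) ?_ ?_
    · rw [interior_Ioo]; exact fun t ht => (h1 t ht).differentiableAt.differentiableWithinAt
    · rw [interior_Ioo]; intro t ht; rw [(h1 t ht).deriv]; exact h2 t ht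
  have m1 : MonotoneOn (fun t => g t + K * t ^ (γ + 1)) (Ioo (0:ℝ) 1) :=
    mono _ _ (fun t ht => (hd t ht).add (hpow t ht))
      (fun t ht => by have := abs_le.1 (hb t ht); linarith [this.1])
  have m2 : MonotoneOn (fun t => K * t ^ (γ + 1) - g t) (Ioo (0:ℝ) 1) :=
    mono _ _ (fun t ht => (hpow t ht).sub (hd t ht))
      (fun t ht => by have := abs_le.1 (hb t ht); linarith [this.2])
  have hK0 : 0 ≤ K := by
    have h := (abs_nonneg _).trans (hb (1/2) ⟨by norm_num, by norm_num⟩)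
    have h2 : (0:ℝ) < (1/2 : ℝ) ^ γ := Real.rpow_pos_of_pos (by norm_num) _
    have : 0 ≤ C := by
      by_contra hc; push Not at hc; nlinarith
    positivity
  have hpos : ∀ t ∈ Ioo (0:ℝ) 1, 0 ≤ K * t ^ (γ + 1) := fun t ht =>
    mul_nonneg hK0 (Real.rpow_nonneg ht.1.le _)
  have hle1 : ∀ t ∈ Ioo (0:ℝ) 1, K * t ^ (γ + 1) ≤ K := fun t ht => by
    have : t ^ (γ + 1) ≤ 1 := Real.rpow_le_one ht.1.le ht.2.le hg2.le
    nlinarith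
  have hbdd : BddBelow ((fun t => g t + K * t ^ (γ + 1)) '' (Ioo (0:ℝ) 1)) := by
    refine ⟨g (1/2) - K - K, ?_⟩
    rintro _ ⟨t, ht, rfl⟩
    have hh : (1/2 : ℝ) ∈ Ioo (0:ℝ) 1 := ⟨by norm_num, by norm_num⟩
    have a1 := hpos t ht
    have a2 := hpos _ hh
    have a3 := hle1 t ht
    have a4 := hle1 _ hh
    rcases le_total t (1/2) with h | h
    · have := m2 ht hh h
      simp only at this ⊢; linarith
    · have := m1 hh ht h
      simp only at this ⊢; linarith
  have ht1 := m1.tendsto_nhdsWithin_Ioo_right (nonempty_Ioo.2 one_pos) hbdd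
  have ht2 : Tendsto (fun t : ℝ => K * t ^ (γ + 1)) (𝓝[>] 0) (𝓝 0) := by
    have := lsum_tendsto [(K, γ + 1)] (by simpa using hg2)
    exact this.congr (fun t => by simp)
  have ht3 := ht1.sub ht2
  rw [sub_zero] at ht3
  set c := sInf ((fun t => g t + K * t ^ (γ + 1)) '' (Ioo (0:ℝ) 1))
  have ht4 : Tendsto g (𝓝[>] 0) (𝓝 c) := ht3.congr (fun t => by ring)
  refine ⟨c, ht4, fun t ht => ?_⟩
  have hev : ∀ᶠ s in 𝓝[>] (0:ℝ), s ∈ Ioo 0 t := Ioo_mem_nhdsGT ht.1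
  have e1 : c ≤ g t + K * t ^ (γ + 1) := by
    refine le_of_tendsto ht4 (hev.mono fun s hs => ?_)
    have hs' : s ∈ Ioo (0:ℝ) 1 := ⟨hs.1, hs.2.trans ht.2⟩
    have := m1 hs' ht hs.2.le
    simp only at this; linarith [hpos s hs']
  have e2 : g t - K * t ^ (γ + 1) ≤ c := by
    refine ge_of_tendsto ht4 (hev.mono fun s hs => ?_)
    have hs' : s ∈ Ioo (0:ℝ) 1 := ⟨hs.1, hs.2.trans ht.2⟩
    have := m2 hs' ht hs.2.le
    simp only at this; linarith [hpos s hs']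
  rw [abs_le]; constructor <;> linarith

lemma Allowed.gt_neg_one {α β e : ℝ} (hα : -1 ≤ α) (hβ : -1 ≤ β) (h : Allowed α β e) : -1 < e := by
  by_cases hz : ∃ z : ℤ, e = (z : ℝ)
  · exact hα.trans_lt (h.1 hz)
  · exact hβ.trans_lt (h.2 hz)

/-- integration of an expansion -/
lemma PR.integrate {α β γ : ℝ} {f f' : ℝ → ℝ} (hα : -1 ≤ α) (hβ : -1 ≤ β) (hγ : -1 < γ)
    (hd : ∀ t ∈ Ioo (0:ℝ) 2, HasDerivAt f (f' t) t) (h : PR α β γ f') :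
    ∃ c, Tendsto f (𝓝[>] 0) (𝓝 c) ∧ PR (α+1) (β+1) (γ+1) (fun t => f t - c) := by
  obtain ⟨L, hL, r, hr, h⟩ := h
  set M := L.map (fun x => (x.1 / (x.2 + 1), x.2 + 1)) with hM
  have hL1 : ∀ x ∈ L, x.2 + 1 ≠ 0 := fun x hx => by
    have := (hL x hx).gt_neg_one hα hβ; linarith
  have hM0 : ∀ x ∈ M, 0 < x.2 := by
    intro x hx
    obtain ⟨y, hy, rfl⟩ := List.mem_map.1 hx
    have := (hL y hy).gt_neg_one hα hβ
    simp only; linarith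
  have hg : ∀ t ∈ Ioo (0:ℝ) 2, HasDerivAt (fun t => f t - lsum M t) (r t) t := by
    intro t ht
    have := (hd t ht).sub (lsum_hasDerivAt L hL1 ht.1)
    refine this.congr_deriv ?_
    rw [h t ht]; ring
  obtain ⟨C, hC⟩ := (hr 0).bound
  obtain ⟨c, hc, hb⟩ := exists_limit hγ (fun t ht => hg t ⟨ht.1, by linarith [ht.2]⟩) hC
  refine ⟨c, ?_, M, ?_, fun t => f t - lsum M t - c, ?_, fun t _ => by ring⟩
  · have := hc.add (lsum_tendsto M hM0)
    rw [add_zero] at this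
    exact this.congr (fun t => by ring)
  · intro x hx
    obtain ⟨y, hy, rfl⟩ := List.mem_map.1 hx
    exact (hL y hy).add_one
  · intro j
    cases j with
    | zero => exact ⟨_, hb⟩
    | succ j =>
      refine ⟨⟨_, hb⟩, r, fun t ht => (hg t ht).sub_const c, ?_⟩
      rw [add_sub_cancel_right]; exact hr j

lemma PR.integrate' {β γ : ℝ} {f f' : ℝ → ℝ} (hβ : -1 ≤ β) (hγ : -1 < γ)
    (hd : ∀ t ∈ Ioo (0:ℝ) 2, HasDerivAt f (f' t) t) (h : PR (-1) β γ f') :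
    PR (-1) (β+1) (γ+1) f := by
  obtain ⟨c, -, hc⟩ := PR.integrate le_rfl hβ hγ hd h
  exact ((hc.mono (by norm_num) le_rfl le_rfl).add (PR.const (β+1) (γ+1) c)).congr
    (fun t _ => by ring)

lemma PR.toRB {α β γ : ℝ} {f : ℝ → ℝ} (hα : -1 ≤ α) (hβ : -1 ≤ β) (hγ : -1 ≤ γ)
    (h : PR α β γ f) (j : ℕ) : RB j (-1) f := by
  obtain ⟨L, hL, r, hr, h⟩ := h
  exact ((lsum_RB L (-1) (fun x hx => ((hL x hx).gt_neg_one hα hβ).le) j).add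
    ((hr j).mono hγ)).congr (fun t ht => (h t ht).symm)

/-- A family of functions closed under differentiation up to terms with known expansion
has itself an expansion. -/
theorem PR.family {ι : Type*} (f : ι → ℝ → ℝ) (σ : ι → ι) (a b : ι → ℝ) (q : ι → ℝ → ℝ)
    {β : ℝ} (hβ : -1 ≤ β)
    (hb : ∀ i, ∃ C : ℝ, ∀ t ∈ Ioo (0:ℝ) 1, |f i t| ≤ C * t ^ (-1/2 : ℝ))
    (hd : ∀ i, ∀ t ∈ Ioo (0:ℝ) 2,
      HasDerivAt (f i) ((a i + b i * t) * f (σ i) t + q i t) t)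
    (hq : ∀ i γ, PR (-1) β γ (q i)) : ∀ i γ, PR (-1) (β+1) γ (f i) := by
  have h0 : ∀ j i, RB j (-1/2) (f i) := by
    intro j
    induction j with
    | zero => exact hb
    | succ j ih =>
      intro i
      refine ⟨hb i, _, hd i, RB.add ?_ ?_⟩
      · have h1 : RB j 0 (fun t => a i + b i * t) :=
          (RB.const j (a i)).add (((RB.rpow j 1 (b i)).mono zero_le_one).congr
            (fun t _ => by simp))
        exact (h1.mul (ih (σ i))).mono (by norm_num)
      · exact ((hq i 0).toRB le_rfl hβ (by norm_num) j).mono (by norm_num)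
  have h1 : ∀ N : ℕ, ∀ i, PR (-1) (β+1) ((N:ℝ) - 1/2) (f i) := by
    intro N
    induction N with
    | zero =>
      intro i
      exact ⟨[], by simp, f i, fun j => (h0 j i).mono (by norm_num), fun t _ => by simp⟩
    | succ N ih =>
      intro i
      have k1 := (((ih (σ i)).mono le_rfl (show β ≤ β + 1 by linarith) le_rfl).linear_mul
        (a i) (b i)).add (hq i ((N:ℝ) - 1/2))
      have := PR.integrate' hβ (by have : (0:ℝ) ≤ N := Nat.cast_nonneg N
                                   linarith) (hd i) k1
      exact this.mono le_rfl le_rfl (by push_cast; linarith)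
  intro i γ
  obtain ⟨N, hN⟩ := exists_nat_gt (γ + 1/2)
  exact (h1 N i).mono le_rfl le_rfl (by linarith)

/-! ### The function `(t(2-t))^{-1/2}` -/

lemma PR.two_sub_rpow (β : ℝ) (hβ : 0 ≤ β) : ∀ a γ : ℝ, PR (-1) β γ (fun t => (2 - t) ^ a) := by
  have := PR.family (fun a t => (2 - t) ^ a) (fun a => a - 1) (fun a => -a) (fun _ => 0)
    (fun _ _ => 0) (β := β - 1) (by linarith) ?_ ?_ (fun _ γ => PR.zero _ _ γ)
  · simpa using this
  · intro a
    have hc : ContinuousOn (fun t : ℝ => (2 - t) ^ a) (Icc 0 1) := by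
      intro t ht
      refine ContinuousAt.continuousWithinAt ?_
      refine ContinuousAt.rpow_const (by fun_prop) (Or.inl ?_)
      linarith [ht.2]
    obtain ⟨C, hC⟩ := isCompact_Icc.exists_bound_of_continuousOn hc
    have : ∃ C : ℝ, ∀ t ∈ Ioo (0:ℝ) 1, |(2 - t) ^ a| ≤ C * t ^ (0:ℝ) :=
      ⟨C, fun t ht => by simpa using hC t ⟨ht.1.le, ht.2.le⟩⟩
    exact bound_mono (by norm_num) this
  · intro a t ht
    have h1 : HasDerivAt (fun t : ℝ => 2 - t) (-1) t := by
      simpa using (hasDerivAt_id t).const_sub 2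
    have := h1.rpow_const (p := a) (Or.inl (by linarith [ht.2]))
    exact this.congr_deriv (by ring)

/-- the arcsine density -/
def wfun (t : ℝ) : ℝ := (Real.sqrt (t * (2 - t)))⁻¹

lemma wfun_eq {t : ℝ} (ht : t ∈ Ioo (0:ℝ) 2) :
    wfun t = t ^ (-1/2 : ℝ) * (2 - t) ^ (-1/2 : ℝ) := by
  have h2 : 0 ≤ 2 - t := by linarith [ht.2]
  rw [wfun, Real.sqrt_eq_rpow, ← Real.rpow_neg (mul_nonneg ht.1.le h2),
    Real.mul_rpow ht.1.le h2]
  norm_num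

lemma half_not_int {e : ℝ} (z : ℤ) (h : e = z) : ¬ ∃ w : ℤ, e + -1/2 = (w : ℝ) := by
  rintro ⟨w, hw⟩
  have h1 : (2:ℝ) * z - 1 = 2 * w := by rw [← h]; linarith
  have h2 : 2 * z - 1 = 2 * w := by exact_mod_cast h1
  omega

lemma wfun_sub (γ : ℝ) :
    PR (-1) 0 γ (fun t => wfun t - 2 ^ (-1/2 : ℝ) * t ^ (-1/2 : ℝ)) := by
  set δ := max (γ + 1/2) 1 with hδ
  have hd : ∀ t ∈ Ioo (0:ℝ) 2, HasDerivAt (fun t : ℝ => (2 - t) ^ (-1/2 : ℝ))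
      (1/2 * (2 - t) ^ (-3/2 : ℝ)) t := by
    intro t ht
    have h1 : HasDerivAt (fun t : ℝ => 2 - t) (-1) t := by
      simpa using (hasDerivAt_id t).const_sub 2
    have := h1.rpow_const (p := -1/2) (Or.inl (by linarith [ht.2]))
    refine this.congr_deriv ?_; norm_num
  obtain ⟨c, hc, hP⟩ := PR.integrate (α := -1) (β := 1) (γ := δ) le_rfl (by norm_num)
    (by linarith [le_max_right (γ + 1/2) 1]) hd
    ((PR.two_sub_rpow 1 (by norm_num) (-3/2) _).const_mul _)
  have hc' : c = 2 ^ (-1/2 : ℝ) := by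
    have : ContinuousAt (fun t : ℝ => (2 - t) ^ (-1/2 : ℝ)) 0 :=
      ContinuousAt.rpow_const (by fun_prop) (Or.inl (by norm_num))
    have := this.tendsto.mono_left (nhdsWithin_le_nhds (s := Ioi 0))
    simp only [sub_zero] at this
    exact tendsto_nhds_unique hc this
  have := hP.mul_rpow (α' := -1) (β' := 0) 1 (-1/2) ?_
  · refine (this.mono le_rfl le_rfl (show γ ≤ δ + 1 + -1/2 by
      linarith [le_max_left (γ + 1/2) 1])).congr (fun t ht => ?_)
    rw [wfun_eq ht, hc']; ring
  · intro e he
    by_cases hz : ∃ z : ℤ, e = (z : ℝ)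
    · obtain ⟨z, hz⟩ := hz
      have h1 := he.1 ⟨z, hz⟩
      rw [hz] at h1
      norm_num at h1
      have h2 : (1:ℝ) ≤ z := by exact_mod_cast h1
      have h3 := half_not_int z hz
      refine ⟨fun h => absurd h h3, fun _ => by rw [hz]; linarith⟩
    · have h1 := he.2 hz
      exact ⟨fun _ => by linarith, fun _ => by linarith⟩

lemma allowed_neg_half : Allowed (-1) (-1) (-1/2) :=
  ⟨fun _ => by norm_num, fun _ => by norm_num⟩

lemma wfun_PR (γ : ℝ) : PR (-1) (-1) γ wfun :=
  (((wfun_sub γ).mono le_rfl (by norm_num) le_rfl).add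
    (PR.monomial γ (2 ^ (-1/2 : ℝ)) allowed_neg_half)).congr (fun t _ => by ring)


/-! ### The Mehler kernel -/

/-- the bivariate Gaussian density with correlation `s` -/
def rho (s x y : ℝ) : ℝ :=
  (2 * Real.pi * Real.sqrt (1 - s ^ 2))⁻¹ *
    Real.exp (-(x ^ 2 - 2 * s * x * y + y ^ 2) / (2 * (1 - s ^ 2)))

/-- its `x`-derivative -/
def rhoX (s x y : ℝ) : ℝ := -(x - s * y) / (1 - s ^ 2) * rho s x y

/-- its mixed derivative -/
def rhoXY (s x y : ℝ) : ℝ :=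
  ((x - s * y) * (y - s * x) / (1 - s ^ 2) ^ 2 + s / (1 - s ^ 2)) * rho s x y

lemma rho_symm (s x y : ℝ) : rho s x y = rho s y x := by
  unfold rho; congr 3; ring

lemma rho_neg (s x y : ℝ) : rho s x (-y) = rho (-s) x y := by
  unfold rho; congr 3 <;> ring_nf

lemma rho_neg' (s x y : ℝ) : rho s (-x) y = rho (-s) x y := by
  unfold rho; congr 3 <;> ring_nf

lemma hasDerivAt_rho_x {s : ℝ} (hs : 0 < 1 - s ^ 2) (x y : ℝ) :
    HasDerivAt (fun x => rho s x y) (rhoX s x y) x := by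
  have h1 : HasDerivAt (fun x : ℝ => -(x ^ 2 - 2 * s * x * y + y ^ 2) / (2 * (1 - s ^ 2)))
      (-(2 * x - 2 * s * y) / (2 * (1 - s ^ 2))) x := by
    have := ((((hasDerivAt_pow 2 x).sub
      (((hasDerivAt_id x).const_mul (2 * s)).mul_const y)).add_const (y ^ 2)).neg).div_const
        (2 * (1 - s ^ 2))
    exact this.congr_deriv (by simp)
  have := h1.exp.const_mul ((2 * Real.pi * Real.sqrt (1 - s ^ 2))⁻¹)
  refine this.congr_deriv ?_
  unfold rhoX rho
  field_simp

lemma hasDerivAt_rhoX_y {s : ℝ} (hs : 0 < 1 - s ^ 2) (x y : ℝ) :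
    HasDerivAt (fun y => rhoX s x y) (rhoXY s x y) y := by
  have h1 : HasDerivAt (fun y => rho s x y) (rhoX s y x) y := by
    simpa only [rho_symm s x] using hasDerivAt_rho_x hs y x
  have h2 : HasDerivAt (fun y : ℝ => -(x - s * y) / (1 - s ^ 2)) (s / (1 - s ^ 2)) y := by
    have := ((((hasDerivAt_id y).const_mul s).const_sub x).neg).div_const (1 - s ^ 2)
    exact this.congr_deriv (by simp)
  refine (h2.mul h1).congr_deriv ?_
  unfold rhoXY rhoX
  rw [rho_symm s y x]
  field_simp
  ring

lemma hasDerivAt_rhoX_zero {s : ℝ} (hs : 0 < 1 - s ^ 2) (x : ℝ) :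
    HasDerivAt (fun x => -s * rhoX s x 0) (rhoXY s x 0) x := by
  have h1 := hasDerivAt_rho_x hs x 0
  have h2 : HasDerivAt (fun x : ℝ => -(x - s * 0) / (1 - s ^ 2)) (-1 / (1 - s ^ 2)) x := by
    have := (((hasDerivAt_id x).sub_const (s * 0)).neg).div_const (1 - s ^ 2)
    exact this.congr_deriv (by simp)
  refine ((h2.mul h1).const_mul (-s)).congr_deriv ?_
  unfold rhoXY rhoX
  field_simp
  ring

lemma hasDerivAt_rho_s {s : ℝ} (hs : 0 < 1 - s ^ 2) (x y : ℝ) :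
    HasDerivAt (fun s => rho s x y) (rhoXY s x y) s := by
  have hpi := Real.pi_pos
  have hq : 0 < Real.sqrt (1 - s ^ 2) := Real.sqrt_pos.2 hs
  have h0 : HasDerivAt (fun s : ℝ => 1 - s ^ 2) (-(2 * s)) s := by
    have := (hasDerivAt_pow 2 s).const_sub 1
    exact this.congr_deriv (by simp)
  have h1 : HasDerivAt (fun s : ℝ => (2 * Real.pi * Real.sqrt (1 - s ^ 2))⁻¹)
      ((2 * Real.pi * Real.sqrt (1 - s ^ 2))⁻¹ * (s / (1 - s ^ 2))) s := by
    have := ((h0.sqrt hs.ne').const_mul (2 * Real.pi)).inv (by positivity)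
    refine this.congr_deriv ?_
    have e : Real.sqrt (1 - s ^ 2) ^ 2 = 1 - s ^ 2 := Real.sq_sqrt hs.le
    rw [show s / (1 - s ^ 2) = s / Real.sqrt (1 - s ^ 2) ^ 2 by rw [e]]
    field_simp
  have h2 : HasDerivAt (fun s : ℝ => -(x ^ 2 - 2 * s * x * y + y ^ 2) / (2 * (1 - s ^ 2)))
      ((x - s * y) * (y - s * x) / (1 - s ^ 2) ^ 2) s := by
    have k1 : HasDerivAt (fun s : ℝ => -(x ^ 2 - 2 * s * x * y + y ^ 2)) (2 * x * y) s := by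
      have := (((((hasDerivAt_id s).const_mul 2).mul_const x).mul_const y).const_sub
        (x ^ 2)).add_const (y ^ 2) |>.neg
      exact this.congr_deriv (by simp)
    have := k1.div (h0.const_mul 2) (by positivity)
    refine this.congr_deriv ?_
    field_simp
    ring
  refine (h1.mul h2.exp).congr_deriv ?_
  unfold rhoXY rho
  ring

/-- Gaussian majorant -/
def gE (x y : ℝ) : ℝ := Real.exp (-(3/16) * (x ^ 2 + y ^ 2))

lemma rho_le {s : ℝ} (hs : 0 < 1 - s ^ 2) (x y : ℝ) :
    rho s x y ≤ (2 * Real.pi * Real.sqrt (1 - s ^ 2))⁻¹ * Real.exp (-(x ^ 2 + y ^ 2) / 4) := by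
  unfold rho
  have hpi := Real.pi_pos
  have hq : 0 < Real.sqrt (1 - s ^ 2) := Real.sqrt_pos.2 hs
  gcongr ?_ * Real.exp ?_
  rw [div_le_div_iff₀ (by positivity) (by positivity)]
  nlinarith [sq_nonneg (x - s * y), sq_nonneg (y - s * x)]

lemma rho_nonneg (s x y : ℝ) : 0 ≤ rho s x y := by
  unfold rho
  have hpi := Real.pi_pos
  positivity

lemma poly_gE (x y : ℝ) : (1 + x ^ 2 + y ^ 2) * Real.exp (-(x ^ 2 + y ^ 2) / 4) ≤ 16 * gE x y := by
  have h1 := Real.add_one_le_exp ((x ^ 2 + y ^ 2) / 16)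
  have h2 : 1 + x ^ 2 + y ^ 2 ≤ 16 * Real.exp ((x ^ 2 + y ^ 2) / 16) := by nlinarith
  calc (1 + x ^ 2 + y ^ 2) * Real.exp (-(x ^ 2 + y ^ 2) / 4)
      ≤ (16 * Real.exp ((x ^ 2 + y ^ 2) / 16)) * Real.exp (-(x ^ 2 + y ^ 2) / 4) := by gcongr
    _ = 16 * gE x y := by
      unfold gE
      rw [mul_assoc, ← Real.exp_add]; congr 2; ring

lemma rho_bounds {δ : ℝ} (hδ : 0 < δ) : ∃ K : ℝ, 0 ≤ K ∧ ∀ s, δ ≤ 1 - s ^ 2 → ∀ x y,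
    |rho s x y| ≤ K * gE x y ∧ |rhoX s x y| ≤ K * gE x y ∧ |rhoXY s x y| ≤ K * gE x y := by
  have hpi := Real.pi_pos
  set A := (2 * Real.pi * Real.sqrt δ)⁻¹ with hA
  have hA0 : 0 ≤ A := by positivity
  have hM0 : 0 ≤ 2 / δ ^ 2 + 1 / δ + 1 := by positivity
  refine ⟨A * (2 / δ ^ 2 + 1 / δ + 1) * 16, by positivity, fun s hs x y => ?_⟩
  have hs0 : 0 < 1 - s ^ 2 := hδ.trans_le hs
  have hs1 : |s| ≤ 1 := abs_le_one_iff_mul_self_le_one.2 (by nlinarith)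
  set P := 1 + x ^ 2 + y ^ 2 with hP
  have hP0 : 0 ≤ P := by positivity
  have hr : rho s x y ≤ A * Real.exp (-(x ^ 2 + y ^ 2) / 4) := by
    refine (rho_le hs0 x y).trans ?_
    have : (2 * Real.pi * Real.sqrt (1 - s ^ 2))⁻¹ ≤ A := by
      have := Real.sqrt_pos.2 hδ
      rw [hA]; gcongr
    gcongr
  have key : ∀ c : ℝ, |c| ≤ (2 / δ ^ 2 + 1 / δ + 1) * P →
      |c * rho s x y| ≤ A * (2 / δ ^ 2 + 1 / δ + 1) * 16 * gE x y := by
    intro c hc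
    rw [abs_mul, abs_of_nonneg (rho_nonneg _ _ _)]
    calc |c| * rho s x y ≤ ((2 / δ ^ 2 + 1 / δ + 1) * P) *
          (A * Real.exp (-(x ^ 2 + y ^ 2) / 4)) := by
          gcongr; exact rho_nonneg _ _ _
      _ = (A * (2 / δ ^ 2 + 1 / δ + 1)) * (P * Real.exp (-(x ^ 2 + y ^ 2) / 4)) := by ring
      _ ≤ (A * (2 / δ ^ 2 + 1 / δ + 1)) * (16 * gE x y) :=
          mul_le_mul_of_nonneg_left (poly_gE x y) (by positivity)
      _ = _ := by ring
  have hP1 : 1 ≤ P := by nlinarith [sq_nonneg x, sq_nonneg y]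
  have i1 : |x - s * y| ≤ |x| + |y| := by
    refine (abs_sub _ _).trans ?_
    rw [abs_mul]; nlinarith [abs_nonneg y]
  have i2 : |y - s * x| ≤ |x| + |y| := by
    refine (abs_sub _ _).trans ?_
    rw [abs_mul]; nlinarith [abs_nonneg x]
  have i3 : |x| + |y| ≤ P := by
    rw [hP, ← sq_abs x, ← sq_abs y]; nlinarith [sq_nonneg (|x| - 1/2), sq_nonneg (|y| - 1/2)]
  have i4 : (|x| + |y|) * (|x| + |y|) ≤ 2 * P := by
    rw [hP, ← sq_abs x, ← sq_abs y]; nlinarith [sq_nonneg (|x| - |y|)]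
  have d1 : 0 ≤ 2 / δ ^ 2 := by positivity
  have d2 : 0 ≤ 1 / δ := by positivity
  refine ⟨?_, ?_, ?_⟩
  · have := key 1 (by rw [abs_one]; nlinarith)
    rwa [one_mul] at this
  · refine key _ ?_
    rw [abs_div, abs_neg, abs_of_pos hs0]
    calc |x - s * y| / (1 - s ^ 2) ≤ P / δ := by
          gcongr; exact i1.trans i3
      _ = 1 / δ * P := by ring
      _ ≤ _ := by nlinarith
  · refine key _ ?_
    refine (abs_add_le _ _).trans ?_
    rw [abs_div, abs_div, abs_mul, abs_of_pos hs0, abs_of_pos (pow_pos hs0 2)]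
    calc |x - s * y| * |y - s * x| / (1 - s ^ 2) ^ 2 + |s| / (1 - s ^ 2)
        ≤ (2 * P) / δ ^ 2 + 1 / δ := by
          gcongr ?_ / ?_ ^ 2 + ?_ / ?_
          exact (mul_le_mul i1 i2 (abs_nonneg _) (by positivity)).trans i4
      _ = 2 / δ ^ 2 * P + 1 / δ * 1 := by ring
      _ ≤ 2 / δ ^ 2 * P + 1 / δ * P := by gcongr
      _ ≤ _ := by nlinarith

lemma continuous_rho (s : ℝ) : Continuous (fun p : ℝ × ℝ => rho s p.1 p.2) := by
  unfold rho; fun_prop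

lemma continuous_rhoX (s : ℝ) : Continuous (fun p : ℝ × ℝ => rhoX s p.1 p.2) := by
  unfold rhoX rho; fun_prop

lemma continuous_rhoXY (s : ℝ) : Continuous (fun p : ℝ × ℝ => rhoXY s p.1 p.2) := by
  unfold rhoXY rho; fun_prop

/-! ### Jets of half-line functions -/

/-- sequence of successive derivatives of a smooth function on `(0,∞)` -/
structure Jet (F : ℕ → ℝ → ℝ) : Prop where
  deriv : ∀ k, ∀ x > 0, HasDerivAt (F k) (F (k+1) x) x
  lim : ∀ k, Tendsto (F k) (𝓝[>] 0) (𝓝 (F k 0))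
  bound : ∀ k, ∃ C, ∀ x > 0, |F k x| ≤ C * Real.exp (x ^ 2 / 8)

lemma Jet.shift {F : ℕ → ℝ → ℝ} (h : Jet F) : Jet (fun k => F (k+1)) :=
  ⟨fun k => h.deriv (k+1), fun k => h.lim (k+1), fun k => h.bound (k+1)⟩

lemma Jet.neg {F : ℕ → ℝ → ℝ} (h : Jet F) : Jet (fun k x => - F k x) :=
  ⟨fun k x hx => (h.deriv k x hx).neg, fun k => (h.lim k).neg, fun k => by
    simpa only [abs_neg] using h.bound k⟩

lemma Jet.continuousOn {F : ℕ → ℝ → ℝ} (h : Jet F) (k : ℕ) : ContinuousOn (F k) (Ioi 0) :=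
  fun x hx => (h.deriv k x hx).continuousAt.continuousWithinAt

lemma jet_mul_le {f v C K x : ℝ} (h1 : |f| ≤ C * Real.exp (x ^ 2 / 8))
    (h2 : |v| ≤ K * gE x 0) : |f * v| ≤ C * K * Real.exp (-(1/16) * x ^ 2) := by
  rw [abs_mul]
  calc |f| * |v| ≤ (C * Real.exp (x ^ 2 / 8)) * (K * gE x 0) :=
        mul_le_mul h1 h2 (abs_nonneg _) ((abs_nonneg _).trans h1)
    _ = C * K * (Real.exp (x ^ 2 / 8) * gE x 0) := by ring
    _ = _ := by unfold gE; rw [← Real.exp_add]; congr 2; ring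

lemma Jet.integrableOn {F : ℕ → ℝ → ℝ} (h : Jet F) (k : ℕ) {v : ℝ → ℝ} {K : ℝ}
    (hv : Continuous v) (hb : ∀ x, |v x| ≤ K * gE x 0) :
    IntegrableOn (fun x => F k x * v x) (Ioi 0) := by
  obtain ⟨C, hC⟩ := h.bound k
  have hg : Integrable (fun x : ℝ => C * K * Real.exp (-(1/16) * x ^ 2)) :=
    (integrable_exp_neg_mul_sq (by norm_num)).const_mul _
  refine Integrable.mono' hg.integrableOn
    (((h.continuousOn k).mul hv.continuousOn).aestronglyMeasurable measurableSet_Ioi) ?_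
  filter_upwards [ae_restrict_mem measurableSet_Ioi] with x hx
  exact jet_mul_le (hC x hx) (hb x)

lemma Jet.ibp {F : ℕ → ℝ → ℝ} (h : Jet F) (k : ℕ) {v v' : ℝ → ℝ} {K : ℝ}
    (hv : ∀ x, HasDerivAt v (v' x) x) (hv' : Continuous v') (hb : ∀ x, |v x| ≤ K * gE x 0)
    (hb' : ∀ x, |v' x| ≤ K * gE x 0) :
    ∫ x in Ioi 0, F k x * v' x = -(F k 0 * v 0) - ∫ x in Ioi 0, F (k+1) x * v x := by
  have hvc : Continuous v := continuous_iff_continuousAt.2 fun x => (hv x).continuousAt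
  have := integral_Ioi_mul_deriv_eq_deriv_mul (a := 0) (u := F k) (u' := F (k+1)) (v := v)
    (v' := v') (a' := F k 0 * v 0) (b' := 0) (h.deriv k) (fun x _ => hv x)
    (h.integrableOn k hv' hb') (h.integrableOn (k+1) hvc hb)
    ((h.lim k).mul ((hvc.tendsto 0).mono_left nhdsWithin_le_nhds)) ?_
  · rw [this]; ring
  · obtain ⟨C, hC⟩ := h.bound k
    have h1 : Tendsto (fun x : ℝ => C * K * Real.exp (-(1/16) * x ^ 2)) atTop (𝓝 0) := by
      have : Tendsto (fun x : ℝ => (1/16) * x ^ 2) atTop atTop :=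
        (tendsto_pow_atTop (by norm_num)).const_mul_atTop (by norm_num)
      have := (Real.tendsto_exp_neg_atTop_nhds_zero.comp this).const_mul (C * K)
      simpa [Function.comp_def, neg_mul] using! this
    refine squeeze_zero_norm' ?_ h1
    filter_upwards [eventually_gt_atTop (0:ℝ)] with x hx
    exact jet_mul_le (hC x hx) (hb x)

/-- Lebesgue measure on `(0,∞)` -/
def mu : Measure ℝ := volume.restrict (Ioi 0)

instance : SFinite mu := by unfold mu; infer_instance

lemma ae_mu_prod : ∀ᵐ p ∂(mu.prod mu), 0 < p.1 ∧ 0 < p.2 := by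
  unfold mu
  rw [Measure.prod_restrict]
  filter_upwards [ae_restrict_mem (measurableSet_Ioi.prod measurableSet_Ioi)] with p hp
  exact ⟨hp.1, hp.2⟩

lemma jet_mul_le2 {f g v C D K x y : ℝ} (h1 : |f| ≤ C * Real.exp (x ^ 2 / 8))
    (h2 : |g| ≤ D * Real.exp (y ^ 2 / 8)) (h3 : |v| ≤ K * gE x y) :
    |f * g * v| ≤ C * D * K * (Real.exp (-(1/16) * x ^ 2) * Real.exp (-(1/16) * y ^ 2)) := by
  rw [abs_mul, abs_mul]
  calc |f| * |g| * |v| ≤ (C * Real.exp (x ^ 2 / 8)) * (D * Real.exp (y ^ 2 / 8)) * (K * gE x y) := by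
        have a1 := (abs_nonneg _).trans h1
        have a2 := (abs_nonneg _).trans h2
        gcongr
    _ = C * D * K * (Real.exp (x ^ 2 / 8) * Real.exp (y ^ 2 / 8) * gE x y) := by ring
    _ = _ := by
        unfold gE; rw [← Real.exp_add, ← Real.exp_add, ← Real.exp_add]; congr 2; ring

lemma integrable_gauss2 : Integrable (fun p : ℝ × ℝ =>
    Real.exp (-(1/16) * p.1 ^ 2) * Real.exp (-(1/16) * p.2 ^ 2)) (mu.prod mu) := by
  have : Integrable (fun x : ℝ => Real.exp (-(1/16) * x ^ 2)) mu :=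
    (integrable_exp_neg_mul_sq (by norm_num)).integrableOn
  exact this.mul_prod this

lemma aesm2 {F G : ℕ → ℝ → ℝ} (hF : Jet F) (hG : Jet G) (k l : ℕ) {κ : ℝ × ℝ → ℝ}
    (hκ : Continuous κ) :
    AEStronglyMeasurable (fun p : ℝ × ℝ => F k p.1 * G l p.2 * κ p) (mu.prod mu) := by
  unfold mu
  rw [Measure.prod_restrict]
  refine ContinuousOn.aestronglyMeasurable ?_ (measurableSet_Ioi.prod measurableSet_Ioi)
  refine ContinuousOn.mul (ContinuousOn.mul ?_ ?_) hκ.continuousOn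
  · exact (hF.continuousOn k).comp continuousOn_fst (fun p hp => hp.1)
  · exact (hG.continuousOn l).comp continuousOn_snd (fun p hp => hp.2)

lemma integrable2 {F G : ℕ → ℝ → ℝ} (hF : Jet F) (hG : Jet G) (k l : ℕ) {κ : ℝ → ℝ → ℝ} {K : ℝ}
    (hκ : Continuous (fun p : ℝ × ℝ => κ p.1 p.2)) (hb : ∀ x y, |κ x y| ≤ K * gE x y) :
    Integrable (fun p : ℝ × ℝ => F k p.1 * G l p.2 * κ p.1 p.2) (mu.prod mu) := by
  obtain ⟨C, hC⟩ := hF.bound k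
  obtain ⟨D, hD⟩ := hG.bound l
  refine Integrable.mono' (integrable_gauss2.const_mul (C * D * K)) (aesm2 hF hG k l hκ) ?_
  filter_upwards [ae_mu_prod] with p hp
  exact jet_mul_le2 (hC _ hp.1) (hD _ hp.2) (hb _ _)

/-- the bilinear form `∫∫ f(x) g(y) ρ_s(x,y)` over the positive quadrant -/
def Bil (f g : ℝ → ℝ) (s : ℝ) : ℝ := ∫ p : ℝ × ℝ, f p.1 * g p.2 * rho s p.1 p.2 ∂(mu.prod mu)

/-- boundary integrals -/
def Nil (g : ℝ → ℝ) (s : ℝ) : ℝ := ∫ x in Ioi 0, g x * rho s x 0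

lemma gE_symm (x y : ℝ) : gE x y = gE y x := by unfold gE; rw [add_comm]

lemma gE_le (x y : ℝ) : gE x y ≤ gE x 0 := by
  unfold gE
  apply Real.exp_le_exp.2
  nlinarith [sq_nonneg y]

lemma ibp2 {F G : ℕ → ℝ → ℝ} (hF : Jet F) (hG : Jet G) {s : ℝ} (hs : 0 < 1 - s ^ 2) :
    ∫ p : ℝ × ℝ, F 0 p.1 * G 0 p.2 * rhoXY s p.1 p.2 ∂(mu.prod mu) =
      Bil (F 1) (G 1) s + F 0 0 * Nil (G 1) s + G 0 0 * Nil (F 1) s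
        + F 0 0 * G 0 0 * rho s 0 0 := by
  obtain ⟨K, hK0, hK⟩ := rho_bounds hs
  replace hK := hK s le_rfl
  have le1 : ∀ x y, K * gE x y ≤ K * gE x 0 := fun x y => by gcongr; exact gE_le x y
  have le2 : ∀ x y, K * gE x y ≤ K * gE y 0 := fun x y => by rw [gE_symm]; exact le1 y x
  have c0 : ∀ x, Continuous (fun y => rhoXY s x y) := fun x =>
    (continuous_rhoXY s).comp (Continuous.prodMk_right x)
  have c1 : ∀ y, Continuous (fun x => rhoX s x y) := fun y =>
    (continuous_rhoX s).comp (Continuous.prodMk_left y)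
  have step1 : ∀ x, ∫ y in Ioi 0, G 0 y * rhoXY s x y =
      -(G 0 0 * rhoX s x 0) - ∫ y in Ioi 0, G 1 y * rhoX s x y := fun x =>
    hG.ibp 0 (fun y => hasDerivAt_rhoX_y hs x y) (c0 x)
      (fun y => (hK x y).2.1.trans (le2 x y)) (fun y => (hK x y).2.2.trans (le2 x y))
  have step2 : ∀ y, ∫ x in Ioi 0, F 0 x * rhoX s x y =
      -(F 0 0 * rho s 0 y) - ∫ x in Ioi 0, F 1 x * rho s x y := fun y =>
    hF.ibp 0 (fun x => hasDerivAt_rho_x hs x y) (c1 y)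
      (fun x => (hK x y).1.trans (le1 x y)) (fun x => (hK x y).2.1.trans (le1 x y))
  have I0 := integrable2 hF hG 0 0 (continuous_rhoXY s) (fun x y => (hK x y).2.2)
  have I1 := integrable2 hF hG 0 1 (continuous_rhoX s) (fun x y => (hK x y).2.1)
  have I2 := integrable2 hF hG 1 1 (continuous_rho s) (fun x y => (hK x y).1)
  have J1 : Integrable (fun x => F 0 x * rhoX s x 0) mu :=
    hF.integrableOn 0 (c1 0) (fun x => (hK x 0).2.1)
  have J2 : Integrable (fun y => G 1 y * rho s y 0) mu :=
    hG.integrableOn 1 ((continuous_rho s).comp (Continuous.prodMk_left 0)) (fun x => (hK x 0).1)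
  have A : ∫ p : ℝ × ℝ, F 0 p.1 * G 0 p.2 * rhoXY s p.1 p.2 ∂(mu.prod mu) =
      -(G 0 0 * ∫ x in Ioi 0, F 0 x * rhoX s x 0)
      - ∫ p : ℝ × ℝ, F 0 p.1 * G 1 p.2 * rhoX s p.1 p.2 ∂(mu.prod mu) := by
    rw [integral_prod _ I0, integral_prod _ I1]
    have e1 : ∀ x, ∫ y, F 0 x * G 0 y * rhoXY s x y ∂mu =
        -G 0 0 * (F 0 x * rhoX s x 0) - ∫ y, F 0 x * G 1 y * rhoX s x y ∂mu := by
      intro x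
      simp only [mul_assoc (F 0 x), integral_const_mul]
      have := step1 x
      unfold mu
      rw [this]; ring
    simp only [e1]
    rw [integral_sub (J1.const_mul _) I1.integral_prod_left, integral_const_mul]
    unfold mu
    ring
  have A2 : ∫ p : ℝ × ℝ, F 0 p.1 * G 1 p.2 * rhoX s p.1 p.2 ∂(mu.prod mu) =
      -(F 0 0 * Nil (G 1) s) - Bil (F 1) (G 1) s := by
    unfold Bil
    rw [integral_prod_symm _ I1, integral_prod_symm _ I2]
    have e1 : ∀ y, ∫ x, F 0 x * G 1 y * rhoX s x y ∂mu =
        -F 0 0 * (G 1 y * rho s y 0) - ∫ x, F 1 x * G 1 y * rho s x y ∂mu := by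
      intro y
      simp only [mul_comm _ (G 1 y), mul_assoc (G 1 y), integral_const_mul]
      have := step2 y
      unfold mu
      rw [this, rho_symm s y 0]; ring
    simp only [e1]
    rw [integral_sub (J2.const_mul _) I2.integral_prod_right, integral_const_mul]
    unfold mu Nil
    ring
  rw [A, A2, step2 0]
  unfold Nil
  ring

lemma nhds_delta {s : ℝ} (hs : 0 < 1 - s ^ 2) :
    {u : ℝ | (1 - s ^ 2) / 2 ≤ 1 - u ^ 2} ∈ 𝓝 s := by
  have : ContinuousAt (fun u : ℝ => 1 - u ^ 2) s := by fun_prop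
  exact this.eventually_const_le (show (1 - s ^ 2) / 2 < 1 - s ^ 2 by linarith)

lemma Bil_hasDerivAt {F G : ℕ → ℝ → ℝ} (hF : Jet F) (hG : Jet G) {s : ℝ} (hs : 0 < 1 - s ^ 2) :
    HasDerivAt (Bil (F 0) (G 0)) (Bil (F 1) (G 1) s + F 0 0 * Nil (G 1) s + G 0 0 * Nil (F 1) s
        + F 0 0 * G 0 0 * rho s 0 0) s := by
  rw [← ibp2 hF hG hs]
  obtain ⟨K, hK0, hK⟩ := rho_bounds (half_pos hs)
  obtain ⟨C, hC⟩ := hF.bound 0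
  obtain ⟨D, hD⟩ := hG.bound 0
  have hs' : (1 - s ^ 2) / 2 ≤ 1 - s ^ 2 := by linarith
  refine (hasDerivAt_integral_of_dominated_loc_of_deriv_le (nhds_delta hs)
    (F := fun s (p : ℝ × ℝ) => F 0 p.1 * G 0 p.2 * rho s p.1 p.2)
    (F' := fun s (p : ℝ × ℝ) => F 0 p.1 * G 0 p.2 * rhoXY s p.1 p.2)
    (Eventually.of_forall fun u => aesm2 hF hG 0 0 (continuous_rho u))
    (integrable2 hF hG 0 0 (continuous_rho s) (fun x y => (hK s hs' x y).1))
    (aesm2 hF hG 0 0 (continuous_rhoXY s)) ?_ (integrable_gauss2.const_mul (C * D * K)) ?_).2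
  · filter_upwards [ae_mu_prod] with p hp u hu
    exact jet_mul_le2 (hC _ hp.1) (hD _ hp.2) (hK u hu _ _).2.2
  · filter_upwards with p u hu
    exact (hasDerivAt_rho_s ((half_pos hs).trans_le hu) _ _).const_mul _

lemma Nil_hasDerivAt {F : ℕ → ℝ → ℝ} (hF : Jet F) {s : ℝ} (hs : 0 < 1 - s ^ 2) :
    HasDerivAt (Nil (F 0)) (-s * (Nil (F 2) s + F 1 0 * rho s 0 0)) s := by
  obtain ⟨K, hK0, hK⟩ := rho_bounds (half_pos hs)
  obtain ⟨C, hC⟩ := hF.bound 0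
  have hs' : (1 - s ^ 2) / 2 ≤ 1 - s ^ 2 := by linarith
  have hs1 : |s| ≤ 1 := abs_le_one_iff_mul_self_le_one.2 (by nlinarith)
  have c0 : ∀ u, Continuous (fun x => rho u x 0) := fun u =>
    (continuous_rho u).comp (Continuous.prodMk_left 0)
  have c1 : ∀ u, Continuous (fun x => rhoX u x 0) := fun u =>
    (continuous_rhoX u).comp (Continuous.prodMk_left 0)
  have c2 : ∀ u, Continuous (fun x => rhoXY u x 0) := fun u =>
    (continuous_rhoXY u).comp (Continuous.prodMk_left 0)
  have e1 : ∫ x in Ioi 0, F 0 x * rhoXY s x 0 = -s * (Nil (F 2) s + F 1 0 * rho s 0 0) := by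
    rw [hF.ibp 0 (v := fun x => -s * rhoX s x 0) (K := K) (fun x => hasDerivAt_rhoX_zero hs x)
      (c2 s) ?_ (fun x => (hK s hs' x 0).2.2)]
    · have e2 : ∫ x in Ioi 0, F (0+1) x * (-s * rhoX s x 0) =
          -s * ∫ x in Ioi 0, F 1 x * rhoX s x 0 := by
        rw [← integral_const_mul]; congr 1; ext x; ring
      rw [e2, hF.ibp 1 (v := fun x => rho s x 0) (K := K) (fun x => hasDerivAt_rho_x hs x 0)
        (c1 s) (fun x => (hK s hs' x 0).1) (fun x => (hK s hs' x 0).2.1)]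
      unfold Nil
      have : rhoX s 0 0 = 0 := by simp [rhoX]
      rw [this]; ring
    · intro x
      rw [abs_mul, abs_neg]
      calc |s| * |rhoX s x 0| ≤ 1 * |rhoX s x 0| := by gcongr
        _ ≤ _ := by rw [one_mul]; exact (hK s hs' x 0).2.1
  rw [← e1]
  have hg : Integrable (fun x : ℝ => C * K * Real.exp (-(1/16) * x ^ 2)) :=
    (integrable_exp_neg_mul_sq (by norm_num)).const_mul _
  refine (hasDerivAt_integral_of_dominated_loc_of_deriv_le (nhds_delta hs)
    (F := fun s x => F 0 x * rho s x 0)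
    (F' := fun s x => F 0 x * rhoXY s x 0)
    (Eventually.of_forall fun u =>
      ((hF.continuousOn 0).mul (c0 u).continuousOn).aestronglyMeasurable measurableSet_Ioi)
    (hF.integrableOn 0 (c0 s) (fun x => (hK s hs' x 0).1))
    (((hF.continuousOn 0).mul (c2 s).continuousOn).aestronglyMeasurable measurableSet_Ioi)
    ?_ (hg.integrableOn) ?_).2
  · filter_upwards [ae_restrict_mem measurableSet_Ioi] with x hx u hu
    exact jet_mul_le (hC _ hx) (hK u hu _ _).2.2
  · filter_upwards with x u hu
    exact (hasDerivAt_rho_s ((half_pos hs).trans_le hu) _ _).const_mul _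

lemma rho_bound_sharp {s : ℝ} (hs : 0 < 1 - s ^ 2) (x y : ℝ) :
    |rho s x y| ≤ (2 * Real.pi * Real.sqrt (1 - s ^ 2))⁻¹ * gE x y := by
  rw [abs_of_nonneg (rho_nonneg _ _ _)]
  refine (rho_le hs x y).trans ?_
  have hpi := Real.pi_pos
  unfold gE
  gcongr
  nlinarith [sq_nonneg x, sq_nonneg y]

lemma Bil_bound {F G : ℕ → ℝ → ℝ} (hF : Jet F) (hG : Jet G) : ∃ C, ∀ s, 0 < 1 - s ^ 2 →
    |Bil (F 0) (G 0) s| ≤ C * (Real.sqrt (1 - s ^ 2))⁻¹ := by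
  obtain ⟨C, hC⟩ := hF.bound 0
  obtain ⟨D, hD⟩ := hG.bound 0
  refine ⟨C * D * (2 * Real.pi)⁻¹ * ∫ p : ℝ × ℝ, Real.exp (-(1/16) * p.1 ^ 2) *
    Real.exp (-(1/16) * p.2 ^ 2) ∂(mu.prod mu), fun s hs => ?_⟩
  have := norm_integral_le_of_norm_le (μ := mu.prod mu)
    (f := fun p : ℝ × ℝ => F 0 p.1 * G 0 p.2 * rho s p.1 p.2)
    (integrable_gauss2.const_mul (C * D * (2 * Real.pi * Real.sqrt (1 - s ^ 2))⁻¹)) ?_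
  · rw [integral_const_mul] at this
    refine this.trans (le_of_eq ?_)
    rw [mul_inv]; ring
  · filter_upwards [ae_mu_prod] with p hp
    exact jet_mul_le2 (hC _ hp.1) (hD _ hp.2) (rho_bound_sharp hs _ _)

lemma Nil_bound {F : ℕ → ℝ → ℝ} (hF : Jet F) : ∃ C, ∀ s, 0 < 1 - s ^ 2 →
    |Nil (F 0) s| ≤ C * (Real.sqrt (1 - s ^ 2))⁻¹ := by
  obtain ⟨C, hC⟩ := hF.bound 0
  have hg : Integrable (fun x : ℝ => Real.exp (-(1/16) * x ^ 2)) mu :=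
    (integrable_exp_neg_mul_sq (by norm_num)).integrableOn
  refine ⟨C * (2 * Real.pi)⁻¹ * ∫ x : ℝ, Real.exp (-(1/16) * x ^ 2) ∂mu, fun s hs => ?_⟩
  have := norm_integral_le_of_norm_le (μ := mu)
    (f := fun x => F 0 x * rho s x 0)
    (hg.const_mul (C * (2 * Real.pi * Real.sqrt (1 - s ^ 2))⁻¹)) ?_
  · rw [integral_const_mul] at this
    refine this.trans (le_of_eq ?_)
    rw [mul_inv]; ring
  · unfold mu
    filter_upwards [ae_restrict_mem measurableSet_Ioi] with x hx
    exact jet_mul_le (hC _ hx) (rho_bound_sharp hs _ _)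


/-! ### Expansions of the basic integrals -/

/-- `Nil` along the boundary parametrization -/
def nfun (τ : ℝ) (F : ℕ → ℝ → ℝ) (t : ℝ) : ℝ := Nil (F 0) (τ * (1 - t))

/-- `Bil` along the boundary parametrization -/
def bfun (τ : ℝ) (F G : ℕ → ℝ → ℝ) (t : ℝ) : ℝ := Bil (F 0) (G 0) (τ * (1 - t))

lemma one_sub_sq {τ : ℝ} (hτ : τ ^ 2 = 1) (t : ℝ) : 1 - (τ * (1 - t)) ^ 2 = t * (2 - t) := by
  rw [mul_pow, hτ]; ring

lemma one_sub_sq_pos {τ : ℝ} (hτ : τ ^ 2 = 1) {t : ℝ} (ht : t ∈ Ioo (0:ℝ) 2) :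
    0 < 1 - (τ * (1 - t)) ^ 2 := by
  rw [one_sub_sq hτ]; exact mul_pos ht.1 (by linarith [ht.2])

lemma rho_zero {τ : ℝ} (hτ : τ ^ 2 = 1) (t : ℝ) :
    rho (τ * (1 - t)) 0 0 = (2 * Real.pi)⁻¹ * wfun t := by
  unfold rho wfun
  rw [one_sub_sq hτ]; simp [mul_comm]

lemma wfun_le {t : ℝ} (ht : t ∈ Ioo (0:ℝ) 1) : wfun t ≤ t ^ (-1/2 : ℝ) := by
  rw [wfun_eq ⟨ht.1, by linarith [ht.2]⟩]
  have h1 : (2 - t) ^ (-1/2 : ℝ) ≤ 1 :=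
    Real.rpow_le_one_of_one_le_of_nonpos (by linarith [ht.2]) (by norm_num)
  have h2 : 0 ≤ t ^ (-1/2 : ℝ) := Real.rpow_nonneg ht.1.le _
  nlinarith

lemma bound_wfun {τ : ℝ} (hτ : τ ^ 2 = 1) {h : ℝ → ℝ}
    (hh : ∃ C, ∀ s, 0 < 1 - s ^ 2 → |h s| ≤ C * (Real.sqrt (1 - s ^ 2))⁻¹) :
    ∃ C : ℝ, ∀ t ∈ Ioo (0:ℝ) 1, |h (τ * (1 - t))| ≤ C * t ^ (-1/2 : ℝ) := by
  obtain ⟨C, hC⟩ := hh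
  refine ⟨|C|, fun t ht => ?_⟩
  have h1 := hC _ (one_sub_sq_pos hτ (t := t) ⟨ht.1, by linarith [ht.2]⟩)
  rw [one_sub_sq hτ] at h1
  have h2 := wfun_le ht
  have h3 : 0 ≤ wfun t := by unfold wfun; positivity
  change _ ≤ C * wfun t at h1
  calc _ ≤ C * wfun t := h1
    _ ≤ |C| * wfun t := by gcongr; exact le_abs_self C
    _ ≤ _ := by gcongr

lemma hasDerivAt_param (τ t : ℝ) : HasDerivAt (fun t : ℝ => τ * (1 - t)) (-τ) t := by
  have := ((hasDerivAt_id t).const_sub 1).const_mul τ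
  exact this.congr_deriv (by simp)

lemma nfun_hasDerivAt {τ : ℝ} (hτ : τ ^ 2 = 1) {F : ℕ → ℝ → ℝ} (hF : Jet F) {t : ℝ}
    (ht : t ∈ Ioo (0:ℝ) 2) :
    HasDerivAt (nfun τ F) ((1 + -1 * t) * nfun τ (fun k => F (k+1+1)) t +
      (1 + -1 * t) * (F 1 0 * (2 * Real.pi)⁻¹ * wfun t)) t := by
  have := (Nil_hasDerivAt hF (one_sub_sq_pos hτ ht)).comp t (hasDerivAt_param τ t)
  refine this.congr_deriv ?_
  rw [rho_zero hτ]
  unfold nfun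
  linear_combination (1 - t) * (Nil (F 2) (τ * (1 - t)) + F 1 0 * ((2 * Real.pi)⁻¹ * wfun t)) * hτ

lemma nfun_PR {τ : ℝ} (hτ : τ ^ 2 = 1) {F : ℕ → ℝ → ℝ} (hF : Jet F) (γ : ℝ) :
    PR (-1) 0 γ (nfun τ F) := by
  have := PR.family (ι := {F : ℕ → ℝ → ℝ // Jet F}) (fun F => nfun τ F.1)
    (fun F => ⟨fun k => F.1 (k+1+1), F.2.shift.shift⟩) (fun _ => 1) (fun _ => -1)
    (fun F t => (1 + -1 * t) * (F.1 1 0 * (2 * Real.pi)⁻¹ * wfun t)) (β := -1) le_rfl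
    (fun F => bound_wfun hτ (Nil_bound F.2))
    (fun F t ht => nfun_hasDerivAt hτ F.2 ht)
    (fun F γ => ((wfun_PR γ).const_mul _).linear_mul 1 (-1)) ⟨F, hF⟩ γ
  simpa using this

lemma bfun_hasDerivAt {τ : ℝ} (hτ : τ ^ 2 = 1) {F G : ℕ → ℝ → ℝ} (hF : Jet F) (hG : Jet G)
    {t : ℝ} (ht : t ∈ Ioo (0:ℝ) 2) :
    HasDerivAt (bfun τ F G) (-τ * (bfun τ (fun k => F (k+1)) (fun k => G (k+1)) t +
      (F 0 0 * nfun τ (fun k => G (k+1)) t + G 0 0 * nfun τ (fun k => F (k+1)) t) +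
      F 0 0 * G 0 0 * (2 * Real.pi)⁻¹ * wfun t)) t := by
  have := (Bil_hasDerivAt hF hG (one_sub_sq_pos hτ ht)).comp t (hasDerivAt_param τ t)
  refine this.congr_deriv ?_
  rw [rho_zero hτ]
  unfold nfun bfun
  ring

lemma bfun_PR {τ : ℝ} (hτ : τ ^ 2 = 1) {F G : ℕ → ℝ → ℝ} (hF : Jet F) (hG : Jet G) (γ : ℝ) :
    PR (-1) 0 γ (bfun τ F G) := by
  have := PR.family (ι := {F : (ℕ → ℝ → ℝ) × (ℕ → ℝ → ℝ) // Jet F.1 ∧ Jet F.2})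
    (fun F => bfun τ F.1.1 F.1.2)
    (fun F => ⟨⟨fun k => F.1.1 (k+1), fun k => F.1.2 (k+1)⟩, F.2.1.shift, F.2.2.shift⟩)
    (fun _ => -τ) (fun _ => 0)
    (fun F t => -τ * ((F.1.1 0 0 * nfun τ (fun k => F.1.2 (k+1)) t +
      F.1.2 0 0 * nfun τ (fun k => F.1.1 (k+1)) t) +
      F.1.1 0 0 * F.1.2 0 0 * (2 * Real.pi)⁻¹ * wfun t)) (β := -1) le_rfl
    (fun F => bound_wfun hτ (Bil_bound F.2.1 F.2.2))
    (fun F t ht => (bfun_hasDerivAt hτ F.2.1 F.2.2 ht).congr_deriv (by ring))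
    (fun F γ => ?_) ⟨⟨F, G⟩, hF, hG⟩ γ
  · simpa using this
  · refine PR.const_mul (PR.add (PR.add ?_ ?_) ((wfun_PR γ).const_mul _)) _
    · exact ((nfun_PR hτ F.2.2.shift γ).mono le_rfl (by norm_num) le_rfl).const_mul _
    · exact ((nfun_PR hτ F.2.1.shift γ).mono le_rfl (by norm_num) le_rfl).const_mul _

/-- the constant `b_0` -/
def b0 : ℝ := 2 * ((2 * Real.pi)⁻¹ * 2 ^ (-1/2 : ℝ))

lemma b0_pos : 0 < b0 := by
  have := Real.pi_pos
  unfold b0; positivity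

lemma hasDerivAt_const_rpow (c e : ℝ) {t : ℝ} (ht : 0 < t) :
    HasDerivAt (fun t : ℝ => c * t ^ e) (c * e * t ^ (e - 1)) t := by
  have := (Real.hasDerivAt_rpow_const (x := t) (p := e) (Or.inl ht.ne')).const_mul c
  exact this.congr_deriv (by ring)

lemma bfun_PR' {τ : ℝ} (hτ : τ ^ 2 = 1) {F G : ℕ → ℝ → ℝ} (hF : Jet F) (hG : Jet G) (γ : ℝ) :
    PR (-1) (1/2) γ
      (fun t => bfun τ F G t - (-τ * (F 0 0 * G 0 0) * b0) * t ^ (1/2 : ℝ)) := by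
  set δ := max γ 0
  have hd : ∀ t ∈ Ioo (0:ℝ) 2, HasDerivAt
      (fun t => bfun τ F G t - (-τ * (F 0 0 * G 0 0) * b0) * t ^ (1/2 : ℝ))
      (-τ * (bfun τ (fun k => F (k+1)) (fun k => G (k+1)) t +
      (F 0 0 * nfun τ (fun k => G (k+1)) t + G 0 0 * nfun τ (fun k => F (k+1)) t) +
      F 0 0 * G 0 0 * (2 * Real.pi)⁻¹ * (wfun t - 2 ^ (-1/2 : ℝ) * t ^ (-1/2 : ℝ)))) t := by
    intro t ht
    have := (bfun_hasDerivAt hτ hF hG ht).sub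
      (hasDerivAt_const_rpow (-τ * (F 0 0 * G 0 0) * b0) (1/2) ht.1)
    refine this.congr_deriv ?_
    rw [show (1/2 : ℝ) - 1 = -1/2 by norm_num]
    unfold b0
    ring
  have hP := PR.integrate' (β := 0) (γ := δ) (by norm_num) (by linarith [le_max_right γ 0]) hd
    (PR.const_mul (PR.add (PR.add (bfun_PR hτ hF.shift hG.shift δ)
      (PR.add ((nfun_PR hτ hG.shift δ).const_mul _) ((nfun_PR hτ hF.shift δ).const_mul _)))
      ((wfun_sub δ).const_mul _)) _)
  exact hP.mono le_rfl (by norm_num) (by linarith [le_max_left γ 0])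

lemma Nil_neg (g : ℝ → ℝ) (s : ℝ) : Nil g (-s) = Nil g s := by
  unfold Nil
  congr 1; ext x
  rw [← rho_neg, neg_zero]

lemma Bil_neg_right (f g : ℝ → ℝ) (s : ℝ) : Bil f (fun x => -g x) s = - Bil f g s := by
  unfold Bil
  rw [← integral_neg]
  congr 1; ext p; ring

lemma Bil_neg_left (f g : ℝ → ℝ) (s : ℝ) : Bil (fun x => -f x) g s = - Bil f g s := by
  unfold Bil
  rw [← integral_neg]
  congr 1; ext p; ring

/-- the dual activation, in terms of the jets on both half-lines -/
def Phi (τ : ℝ) (F G : ℕ → ℝ → ℝ) (t : ℝ) : ℝ :=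
  bfun τ F F t + bfun τ G G t + 2 * bfun (-τ) F G t

lemma Phi_hasDerivAt {τ : ℝ} (hτ : τ ^ 2 = 1) {F G : ℕ → ℝ → ℝ} (hF : Jet F) (hG : Jet G)
    (h0 : F 0 0 = G 0 0) {t : ℝ} (ht : t ∈ Ioo (0:ℝ) 2) :
    HasDerivAt (Phi τ F G) (-τ * Phi τ (fun k => F (k+1)) (fun k x => -G (k+1) x) t) t := by
  have hτ' : (-τ) ^ 2 = 1 := by rw [neg_sq, hτ]
  have := ((bfun_hasDerivAt hτ hF hF ht).add (bfun_hasDerivAt hτ hG hG ht)).add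
    ((bfun_hasDerivAt hτ' hF hG ht).const_mul 2)
  refine this.congr_deriv ?_
  unfold Phi bfun nfun
  simp only [Bil_neg_left, Bil_neg_right, neg_mul, Nil_neg, h0]
  ring

theorem Phi_expansion (m : ℕ) : ∃ b : ℝ, 0 < b ∧ ∀ F G : ℕ → ℝ → ℝ, Jet F → Jet G →
    (∀ k < m, F k 0 = (-1) ^ k * G k 0) → ∀ τ : ℝ, τ ^ 2 = 1 → ∀ γ : ℝ,
      PR (-1) ((m:ℝ) + 1/2) γ (fun t => Phi τ F G t -
        (F m 0 - (-1) ^ m * G m 0) ^ 2 * (-τ) ^ (m+1) * b * t ^ ((m:ℝ) + 1/2)) := by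
  induction m with
  | zero =>
    refine ⟨b0, b0_pos, fun F G hF hG _ τ hτ γ => ?_⟩
    have hτ' : (-τ) ^ 2 = 1 := by rw [neg_sq, hτ]
    have := ((bfun_PR' hτ hF hF γ).add (bfun_PR' hτ hG hG γ)).add
      ((bfun_PR' hτ' hF hG γ).const_mul 2)
    refine (this.mono le_rfl (by simp) le_rfl).congr (fun t _ => ?_)
    unfold Phi
    simp only [Nat.cast_zero, zero_add, pow_zero, pow_one]
    ring
  | succ m ih =>
    obtain ⟨b, hb, H⟩ := ih
    have hm : (0:ℝ) ≤ m := Nat.cast_nonneg m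
    refine ⟨b / ((m:ℝ) + 3/2), by positivity, fun F G hF hG h0 τ hτ γ => ?_⟩
    set δ := max γ 0
    have h00 : F 0 0 = G 0 0 := by simpa using h0 0 (Nat.succ_pos m)
    have hP := H (fun k => F (k+1)) (fun k x => -G (k+1) x) hF.shift hG.shift.neg
      (fun k hk => by rw [h0 (k+1) (by omega)]; ring) τ hτ δ
    have hd : ∀ t ∈ Ioo (0:ℝ) 2, HasDerivAt (fun t => Phi τ F G t -
        (F (m+1) 0 - (-1) ^ (m+1) * G (m+1) 0) ^ 2 * (-τ) ^ (m+1+1) * (b / ((m:ℝ) + 3/2))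
          * t ^ (((m+1:ℕ):ℝ) + 1/2))
        (-τ * (Phi τ (fun k => F (k+1)) (fun k x => -G (k+1) x) t -
        (F (m+1) 0 - (-1) ^ m * -G (m+1) 0) ^ 2 * (-τ) ^ (m+1) * b * t ^ ((m:ℝ) + 1/2))) t := by
      intro t ht
      refine ((Phi_hasDerivAt hτ hF hG h00 ht).sub (hasDerivAt_const_rpow _ _ ht.1)).congr_deriv ?_
      rw [show ((m+1:ℕ):ℝ) + 1/2 - 1 = (m:ℝ) + 1/2 by push_cast; ring,
        show ((m+1:ℕ):ℝ) + 1/2 = (m:ℝ) + 3/2 by push_cast; ring]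
      have : (m:ℝ) + 3/2 ≠ 0 := by positivity
      field_simp
      ring
    have := PR.integrate' (by linarith) (by linarith [le_max_right γ 0]) hd (hP.const_mul (-τ))
    exact this.mono le_rfl (by push_cast; linarith) (by linarith [le_max_left γ 0])

/-- Change of variables: the dual activation as an integral against the bivariate density. -/
theorem dualAct_eq_integral_rho (φ : ℝ → ℝ) {s : ℝ} (hs : 0 < 1 - s ^ 2) :
    dualAct φ s = ∫ p : ℝ × ℝ, φ p.1 * φ p.2 * rho s p.1 p.2 := by
  have h1 : 0 < 1 + s := by nlinarith
  have h2 : 0 < 1 - s := by nlinarith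
  set a := Real.sqrt ((1 + s) / 2) with ha
  set b := Real.sqrt ((1 - s) / 2) with hb
  have ha2 : a ^ 2 = (1 + s) / 2 := Real.sq_sqrt (by positivity)
  have hb2 : b ^ 2 = (1 - s) / 2 := Real.sq_sqrt (by positivity)
  have ha0 : 0 < a := Real.sqrt_pos.2 (by positivity)
  have hb0 : 0 < b := Real.sqrt_pos.2 (by positivity)
  have hab : Real.sqrt (1 - s ^ 2) = 2 * a * b := by
    rw [Real.sqrt_eq_iff_mul_self_eq hs.le (by positivity)]
    have : 2 * a * b * (2 * a * b) = 4 * a ^ 2 * b ^ 2 := by ring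
    rw [this, ha2, hb2]; ring
  let L : (ℝ × ℝ) →ₗ[ℝ] (ℝ × ℝ) :=
    Matrix.toLin (Module.Basis.finTwoProd ℝ) (Module.Basis.finTwoProd ℝ) !![a, b; a, -b]
  have hL : ∀ p : ℝ × ℝ, L p = (a * p.1 + b * p.2, a * p.1 - b * p.2) := by
    intro p
    simp only [L, Matrix.toLin_finTwoProd_apply]
    ext <;> simp [sub_eq_add_neg]
  have hdet : LinearMap.det L = -(2 * a * b) := by
    simp only [L, LinearMap.det_toLin, Matrix.det_fin_two_of]; ring
  have hdet0 : LinearMap.det L ≠ 0 := by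
    rw [hdet]; exact neg_ne_zero.2 (by positivity)
  have hmap := Measure.map_linearMap_addHaar_eq_smul_addHaar
    (volume : Measure (ℝ × ℝ)) hdet0
  have hinj : LinearMap.ker L = ⊥ :=
    LinearMap.ker_eq_bot.2 ((LinearEquiv.ofIsUnitDet
      (v := Module.Basis.finTwoProd ℝ) (v' := Module.Basis.finTwoProd ℝ) (f := L)
      (by rw [LinearMap.det_toMatrix]; exact hdet0.isUnit)).injective)
  have hemb : MeasurableEmbedding L :=
    (LinearMap.isClosedEmbedding_of_injective hinj).measurableEmbedding
  have hcov := hemb.integral_map (μ := volume)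
    (fun p : ℝ × ℝ => φ p.1 * φ p.2 * rho s p.1 p.2)
  rw [hmap, integral_smul_measure] at hcov
  have hd : |(LinearMap.det L)⁻¹| = (2 * a * b)⁻¹ := by
    rw [hdet, inv_neg, abs_neg, abs_of_pos (by positivity)]
  rw [hd, ENNReal.toReal_ofReal (by positivity), smul_eq_mul] at hcov
  have hkey : ∫ p : ℝ × ℝ, φ p.1 * φ p.2 * rho s p.1 p.2 =
      (2 * a * b) * ∫ p : ℝ × ℝ, φ (L p).1 * φ (L p).2 * rho s (L p).1 (L p).2 := by
    rw [← hcov]; field_simp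
  rw [hkey, ← integral_const_mul]
  unfold dualAct
  have hst : _root_.stdGaussian = volume.withDensity (gaussianPDF 0 1) :=
    gaussianReal_of_var_ne_zero 0 one_ne_zero
  rw [hst, prod_withDensity (measurable_gaussianPDF 0 1) (measurable_gaussianPDF 0 1),
    integral_withDensity_eq_integral_toReal_smul
      (by have := measurable_gaussianPDF 0 1; fun_prop)
      (ae_of_all _ fun p => ENNReal.mul_lt_top gaussianPDF_lt_top gaussianPDF_lt_top)]
  refine integral_congr_ae (ae_of_all _ fun p => ?_)
  simp only [hL, ENNReal.toReal_mul, toReal_gaussianPDF, gaussianPDFReal_def, smul_eq_mul, ← ha,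
    ← hb, rho, hab]
  have he : -((a * p.1 + b * p.2) ^ 2 - 2 * s * (a * p.1 + b * p.2) * (a * p.1 - b * p.2) +
      (a * p.1 - b * p.2) ^ 2) / (2 * (1 - s ^ 2)) = -p.1 ^ 2 / 2 + -p.2 ^ 2 / 2 := by
    have : (a * p.1 + b * p.2) ^ 2 - 2 * s * (a * p.1 + b * p.2) * (a * p.1 - b * p.2) +
      (a * p.1 - b * p.2) ^ 2 = 2 * (1 - s) * a ^ 2 * p.1 ^ 2 + 2 * (1 + s) * b ^ 2 * p.2 ^ 2 := by
      ring
    rw [this, ha2, hb2]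
    field_simp
    ring
  rw [he, Real.exp_add]
  have hpi : (Real.sqrt (2 * Real.pi)) ^ 2 = 2 * Real.pi := Real.sq_sqrt (by positivity)
  have hpi2 : (Real.sqrt (2 * Real.pi))⁻¹ * (Real.sqrt (2 * Real.pi))⁻¹ = (2 * Real.pi)⁻¹ := by
    rw [← hpi]
    have : 0 < Real.sqrt (2 * Real.pi) := Real.sqrt_pos.2 (by positivity)
    rw [Real.sqrt_sq this.le]
    field_simp
  have hpi3 : (2 * a * b) * (2 * Real.pi * (2 * a * b))⁻¹ = (2 * Real.pi)⁻¹ := by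
    field_simp
  simp only [NNReal.coe_one, mul_one, sub_zero]
  linear_combination (φ (a * p.1 + b * p.2) * φ (a * p.1 - b * p.2) *
    Real.exp (-p.1 ^ 2 / 2) * Real.exp (-p.2 ^ 2 / 2)) * (hpi2 - hpi3)

theorem volume_eq_mu : (volume : Measure ℝ) = mu + mu.map Neg.neg := by
  have h1 : mu.map Neg.neg = (volume : Measure ℝ).restrict (Iio 0) := by
    have h := (MeasurableEquiv.neg ℝ).measurableEmbedding.restrict_map
      (volume : Measure ℝ) (Iio 0)
    have h0 : Measure.map (MeasurableEquiv.neg ℝ) (volume : Measure ℝ) = volume :=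
      Measure.map_neg_eq_self volume
    rw [h0] at h
    rw [h]
    have : (MeasurableEquiv.neg ℝ) ⁻¹' (Iio (0:ℝ)) = Ioi 0 := by
      ext x; simp
    rw [this]; rfl
  rw [h1, mu, ← Measure.restrict_union (by
    rw [Set.disjoint_left]; intro x hx hx'; simp at hx hx'; linarith) measurableSet_Iio]
  symm
  apply Measure.restrict_eq_self_of_ae_mem
  have : ∀ᵐ x : ℝ, x ≠ 0 := by simp [ae_iff]
  filter_upwards [this] with x hx
  rcases lt_or_gt_of_ne hx with h | h
  · right; exact h
  · left; exact h

/-- Quadrant decomposition of the integral. -/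
theorem integral_quadrants {F G : ℕ → ℝ → ℝ} (hF : Jet F) (hG : Jet G) {φ : ℝ → ℝ}
    (h1 : ∀ x > 0, φ x = F 0 x) (h2 : ∀ x > 0, φ (-x) = G 0 x) {s : ℝ} (hs : 0 < 1 - s ^ 2) :
    ∫ p : ℝ × ℝ, φ p.1 * φ p.2 * rho s p.1 p.2 =
      Bil (F 0) (F 0) s + Bil (G 0) (G 0) s + 2 * Bil (F 0) (G 0) (-s) := by
  have hs' : 0 < 1 - (-s) ^ 2 := by simpa using hs
  have hI : ∀ {A B : ℕ → ℝ → ℝ} {r : ℝ}, Jet A → Jet B → 0 < 1 - r ^ 2 →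
      Integrable (fun p : ℝ × ℝ => A 0 p.1 * B 0 p.2 * rho r p.1 p.2) (mu.prod mu) := by
    intro A B r hA hB hr
    obtain ⟨K, -, hK⟩ := rho_bounds hr
    exact integrable2 hA hB 0 0 (continuous_rho r) (fun x y => (hK r le_rfl x y).1)
  set H : ℝ × ℝ → ℝ := fun p => φ p.1 * φ p.2 * rho s p.1 p.2 with hH
  have hn : MeasurableEmbedding (Neg.neg : ℝ → ℝ) := (MeasurableEquiv.neg ℝ).measurableEmbedding
  have hi : MeasurableEmbedding (id : ℝ → ℝ) := MeasurableEmbedding.id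
  have e2 : mu.prod (mu.map Neg.neg) = (mu.prod mu).map (Prod.map id Neg.neg) := by
    rw [← Measure.map_prod_map _ _ measurable_id measurable_neg, Measure.map_id]
  have e3 : (mu.map Neg.neg).prod mu = (mu.prod mu).map (Prod.map Neg.neg id) := by
    rw [← Measure.map_prod_map _ _ measurable_neg measurable_id, Measure.map_id]
  have e4 : (mu.map Neg.neg).prod (mu.map Neg.neg) =
      (mu.prod mu).map (Prod.map Neg.neg Neg.neg) := by
    rw [← Measure.map_prod_map _ _ measurable_neg measurable_neg]
  have m2 : MeasurableEmbedding (Prod.map (id : ℝ → ℝ) (Neg.neg : ℝ → ℝ)) := hi.prodMap hn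
  have m3 : MeasurableEmbedding (Prod.map (Neg.neg : ℝ → ℝ) (id : ℝ → ℝ)) := hn.prodMap hi
  have m4 : MeasurableEmbedding (Prod.map (Neg.neg : ℝ → ℝ) (Neg.neg : ℝ → ℝ)) := hn.prodMap hn
  have c1 : H =ᵐ[mu.prod mu] fun p => F 0 p.1 * F 0 p.2 * rho s p.1 p.2 := by
    filter_upwards [ae_mu_prod] with p hp
    simp only [hH, h1 _ hp.1, h1 _ hp.2]
  have c2 : (H ∘ Prod.map id Neg.neg) =ᵐ[mu.prod mu]
      fun p => F 0 p.1 * G 0 p.2 * rho (-s) p.1 p.2 := by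
    filter_upwards [ae_mu_prod] with p hp
    simp only [hH, Function.comp, Prod.map, id, h1 _ hp.1, h2 _ hp.2, rho_neg]
  have c3 : (H ∘ Prod.map Neg.neg id) =ᵐ[mu.prod mu]
      fun p => G 0 p.1 * F 0 p.2 * rho (-s) p.1 p.2 := by
    filter_upwards [ae_mu_prod] with p hp
    simp only [hH, Function.comp, Prod.map, id, h2 _ hp.1, h1 _ hp.2, rho_neg']
  have c4 : (H ∘ Prod.map Neg.neg Neg.neg) =ᵐ[mu.prod mu]
      fun p => G 0 p.1 * G 0 p.2 * rho s p.1 p.2 := by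
    filter_upwards [ae_mu_prod] with p hp
    simp only [hH, Function.comp, Prod.map, h2 _ hp.1, h2 _ hp.2, rho_neg, rho_neg', neg_neg]
  have i1 : Integrable H (mu.prod mu) := (integrable_congr c1).2 (hI hF hF hs)
  have i2 : Integrable H (mu.prod (mu.map Neg.neg)) := by
    rw [e2, m2.integrable_map_iff]; exact (integrable_congr c2).2 (hI hF hG hs')
  have i3 : Integrable H ((mu.map Neg.neg).prod mu) := by
    rw [e3, m3.integrable_map_iff]; exact (integrable_congr c3).2 (hI hG hF hs')
  have i4 : Integrable H ((mu.map Neg.neg).prod (mu.map Neg.neg)) := by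
    rw [e4, m4.integrable_map_iff]; exact (integrable_congr c4).2 (hI hG hG hs)
  have hv : (volume : Measure (ℝ × ℝ)) = (mu.prod mu + mu.prod (mu.map Neg.neg)) +
      ((mu.map Neg.neg).prod mu + (mu.map Neg.neg).prod (mu.map Neg.neg)) := by
    rw [Measure.volume_eq_prod, volume_eq_mu, Measure.add_prod, Measure.prod_add,
      Measure.prod_add]
  rw [hv, integral_add_measure (i1.add_measure i2) (i3.add_measure i4),
    integral_add_measure i1 i2, integral_add_measure i3 i4]
  have j1 : ∫ p, H p ∂(mu.prod mu) = Bil (F 0) (F 0) s := integral_congr_ae c1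
  have j2 : ∫ p, H p ∂(mu.prod (mu.map Neg.neg)) = Bil (F 0) (G 0) (-s) := by
    rw [e2, m2.integral_map]; exact integral_congr_ae c2
  have j3' : ∫ p, H p ∂((mu.map Neg.neg).prod mu) = Bil (G 0) (F 0) (-s) := by
    rw [e3, m3.integral_map]; exact integral_congr_ae c3
  have j4 : ∫ p, H p ∂((mu.map Neg.neg).prod (mu.map Neg.neg)) = Bil (G 0) (G 0) s := by
    rw [e4, m4.integral_map]; exact integral_congr_ae c4
  have sw : Bil (G 0) (F 0) (-s) = Bil (F 0) (G 0) (-s) := by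
    unfold Bil
    rw [← integral_prod_swap]
    refine integral_congr_ae (ae_of_all _ fun p => ?_)
    simp only [Prod.fst_swap, Prod.snd_swap]
    rw [rho_symm]; ring
  rw [j1, j2, j3', j4, sw]
  ring

theorem poly_le_exp (a b q : ℝ) (ha : 0 < a) (hb : 0 < b) (hq : 0 < q) :
    ∃ C : ℝ, ∀ x > 0, a * |x| ^ q + b ≤ C * Real.exp (x ^ 2 / 8) := by
  obtain ⟨n, hn⟩ := exists_nat_ge q
  refine ⟨a * (1 + 8 ^ n * n.factorial) + b, fun x hx => ?_⟩
  have hE : 1 ≤ Real.exp (x ^ 2 / 8) := Real.one_le_exp (by positivity)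
  have h1 : |x| ^ q ≤ 1 + (x ^ 2) ^ n := by
    rw [abs_of_pos hx]
    rcases le_total x 1 with h | h
    · have := Real.rpow_le_one hx.le h hq.le
      have : 0 ≤ (x ^ 2) ^ n := by positivity
      linarith
    · have h2 : x ^ q ≤ x ^ (n : ℝ) := Real.rpow_le_rpow_of_exponent_le h hn
      rw [Real.rpow_natCast] at h2
      have h3 : x ^ n ≤ (x ^ 2) ^ n := pow_le_pow_left₀ hx.le (by nlinarith) n
      linarith
  have h2 : (x ^ 2) ^ n ≤ 8 ^ n * n.factorial * Real.exp (x ^ 2 / 8) := by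
    have := Real.pow_div_factorial_le_exp (x := x ^ 2 / 8) (by positivity) n
    rw [div_le_iff₀ (by positivity), div_pow, div_le_iff₀ (by positivity)] at this
    linarith
  have h3 : |x| ^ q ≤ (1 + 8 ^ n * n.factorial) * Real.exp (x ^ 2 / 8) := by
    rw [add_mul, one_mul]; linarith
  calc a * |x| ^ q + b ≤ a * ((1 + 8 ^ n * n.factorial) * Real.exp (x ^ 2 / 8))
        + b * Real.exp (x ^ 2 / 8) :=
        add_le_add (mul_le_mul_of_nonneg_left h3 ha.le) (le_mul_of_one_le_right hb.le hE)
    _ = _ := by ring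

/-- The jet of a function smooth on `(0,∞)`, extended to `0` by limits. -/
def jetOf (ψ : ℝ → ℝ) (k : ℕ) (x : ℝ) : ℝ :=
  if x = 0 then limUnder (𝓝[>] 0) (iteratedDerivWithin k ψ (Ioi 0))
  else iteratedDerivWithin k ψ (Ioi 0) x

theorem jetOf_zero (ψ : ℝ → ℝ) (k : ℕ) :
    jetOf ψ k 0 = limUnder (𝓝[>] 0) (iteratedDerivWithin k ψ (Ioi 0)) := if_pos rfl

theorem jetOf_pos (ψ : ℝ → ℝ) (k : ℕ) {x : ℝ} (hx : 0 < x) :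
    jetOf ψ k x = iteratedDerivWithin k ψ (Ioi 0) x := if_neg hx.ne'

theorem jetOf_tendsto {ψ : ℝ → ℝ} (hψ : ContDiffOn ℝ (⊤ : ℕ∞) ψ (Ioi (0 : ℝ)))
    (hb : ∀ m : ℕ, ∃ a b q : ℝ, 0 < a ∧ 0 < b ∧ 0 < q ∧
      ∀ x : ℝ, 0 < x → |iteratedDerivWithin m ψ (Ioi (0 : ℝ)) x| ≤ a * |x| ^ q + b) :
    (∀ k, ∀ x > 0, HasDerivAt (iteratedDerivWithin k ψ (Ioi 0))
      (iteratedDerivWithin (k + 1) ψ (Ioi 0) x) x) ∧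
    ∀ k, Tendsto (iteratedDerivWithin k ψ (Ioi 0)) (𝓝[>] 0) (𝓝 (jetOf ψ k 0)) := by
  have hd : ∀ k, ∀ x > 0, HasDerivAt (iteratedDerivWithin k ψ (Ioi 0))
      (iteratedDerivWithin (k + 1) ψ (Ioi 0) x) x := by
    intro k x hx
    have h1 := hψ.differentiableOn_iteratedDerivWithin (m := k)
      (by exact_mod_cast WithTop.coe_lt_top _) (uniqueDiffOn_Ioi 0) x hx
    have h2 := (h1.differentiableAt (Ioi_mem_nhds hx)).hasDerivAt
    rw [iteratedDerivWithin_succ, derivWithin_of_isOpen isOpen_Ioi hx]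
    exact h2
  refine ⟨hd, fun k => ?_⟩
  obtain ⟨a, b, q, ha, hb0, hq, hbd⟩ := hb (k + 1)
  obtain ⟨c, hc, -⟩ := exists_limit (γ := 0) (C := a + b) (by norm_num)
    (fun t (ht : t ∈ Ioo (0:ℝ) 1) => hd k t ht.1) (by
      intro t ht
      refine (hbd t ht.1).trans ?_
      rw [abs_of_pos ht.1, Real.rpow_zero, mul_one]
      have := Real.rpow_le_one ht.1.le ht.2.le hq.le
      nlinarith)
  rw [jetOf_zero, hc.limUnder_eq]
  exact hc

theorem jetOf_jet {ψ : ℝ → ℝ} (hψ : ContDiffOn ℝ (⊤ : ℕ∞) ψ (Ioi (0 : ℝ)))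
    (hb : ∀ m : ℕ, ∃ a b q : ℝ, 0 < a ∧ 0 < b ∧ 0 < q ∧
      ∀ x : ℝ, 0 < x → |iteratedDerivWithin m ψ (Ioi (0 : ℝ)) x| ≤ a * |x| ^ q + b) :
    Jet (jetOf ψ) := by
  obtain ⟨hd, hl⟩ := jetOf_tendsto hψ hb
  refine ⟨fun k x hx => ?_, fun k => ?_, fun k => ?_⟩
  · rw [jetOf_pos ψ (k + 1) hx]
    refine (hd k x hx).congr_of_eventuallyEq ?_
    filter_upwards [Ioi_mem_nhds hx] with y hy
    exact jetOf_pos ψ k hy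
  · refine (hl k).congr' ?_
    filter_upwards [self_mem_nhdsWithin] with y hy
    exact (jetOf_pos ψ k hy).symm
  · obtain ⟨a, b, q, ha, hb0, hq, hbd⟩ := hb k
    obtain ⟨C, hC⟩ := poly_le_exp a b q ha hb0 hq
    refine ⟨C, fun x hx => ?_⟩
    rw [jetOf_pos ψ k hx]
    exact (hbd x hx).trans (hC x hx)

theorem iter_neg (φ : ℝ → ℝ) (k : ℕ) (x : ℝ) :
    iteratedDerivWithin k (fun x => φ (-x)) (Ioi 0) x =
      (-1) ^ k * iteratedDerivWithin k φ (Iio 0) (-x) := by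
  rw [iteratedDerivWithin_comp_neg]
  simp

theorem activation_jets {φ : ℝ → ℝ} (h : IsActivation φ) :
    ∃ F G : ℕ → ℝ → ℝ, Jet F ∧ Jet G ∧ (∀ x > 0, φ x = F 0 x) ∧ (∀ x > 0, φ (-x) = G 0 x) ∧
      ∀ k, deltaK φ k = F k 0 - (-1) ^ k * G k 0 := by
  obtain ⟨s1, s2, b1, b2, -, -⟩ := h
  have s2' : ContDiffOn ℝ (⊤ : ℕ∞) (fun x => φ (-x)) (Ioi (0 : ℝ)) :=
    s2.comp contDiff_neg.contDiffOn (fun x hx => by simpa using hx)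
  have b2' : ∀ m : ℕ, ∃ a b q : ℝ, 0 < a ∧ 0 < b ∧ 0 < q ∧ ∀ x : ℝ, 0 < x →
      |iteratedDerivWithin m (fun x => φ (-x)) (Ioi (0 : ℝ)) x| ≤ a * |x| ^ q + b := by
    intro m
    obtain ⟨a, b, q, ha, hb, hq, hbd⟩ := b2 m
    refine ⟨a, b, q, ha, hb, hq, fun x hx => ?_⟩
    have := hbd (-x) (by linarith)
    rw [abs_neg] at this
    rw [iter_neg, abs_mul, abs_pow, abs_neg, abs_one, one_pow, one_mul]
    exact this
  refine ⟨jetOf φ, jetOf fun x => φ (-x), jetOf_jet s1 b1, jetOf_jet s2' b2', ?_, ?_, ?_⟩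
  · intro x hx; rw [jetOf_pos _ _ hx, iteratedDerivWithin_zero]
  · intro x hx; rw [jetOf_pos _ _ hx, iteratedDerivWithin_zero]
  · intro k
    have hl := (jetOf_tendsto s2' b2').2 k
    have ht : Tendsto (Neg.neg : ℝ → ℝ) (𝓝[<] 0) (𝓝[>] 0) := by
      simpa using tendsto_neg_nhdsLT (a := (0 : ℝ))
    have h2 := (hl.comp ht).const_mul ((-1 : ℝ) ^ k)
    have h3 : (fun x => (-1 : ℝ) ^ k *
        ((iteratedDerivWithin k (fun x => φ (-x)) (Ioi 0)) ∘ Neg.neg) x) =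
        iteratedDerivWithin k φ (Iio 0) := by
      funext x
      simp only [Function.comp, iter_neg, neg_neg]
      rw [← mul_assoc, ← mul_pow]; simp
    rw [h3] at h2
    unfold deltaK
    rw [h2.limUnder_eq, jetOf_zero φ]

/-- boundary behavior of dual activations: for each `m` there is a constant
`b_m > 0` depending only on `m` such that for every activation `φ` with `Δ_k(φ) = 0` for
`k < m`, and every `τ ∈ {−1,1}`,
`φ̂(τ(1−t)) = Δ_m(φ)² (−τ)^{m+1} b_m t^{m+1/2} + Q_{−1,m+1/2}(t)`. -/
theorem dualAct_boundary (m : ℕ) :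
    ∃ b : ℝ, 0 < b ∧ ∀ φ : ℝ → ℝ, IsActivation φ → (∀ k < m, deltaK φ k = 0) →
      ∀ τ : ℝ, (τ = 1 ∨ τ = -1) →
        (fun t : ℝ => dualAct φ (τ * (1 - t))
            - (deltaK φ m) ^ 2 * (-τ) ^ (m + 1) * b * t ^ ((m : ℝ) + 1 / 2))
          ∈ Qclass (-1) ((m : ℝ) + 1 / 2) := by
  obtain ⟨b, hb, H⟩ := Phi_expansion m
  refine ⟨b, hb, fun φ hφ h0 τ hτ => ?_⟩
  obtain ⟨F, G, hF, hG, h1, h2, h3⟩ := activation_jets hφ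
  have hτ2 : τ ^ 2 = 1 := by rcases hτ with h | h <;> rw [h] <;> norm_num
  refine PR.mem_Qclass fun γ => ?_
  refine (H F G hF hG (fun k hk => ?_) τ hτ2 γ).congr fun t ht => ?_
  · have := h0 k hk
    rw [h3 k] at this
    linarith
  · have hs := one_sub_sq_pos hτ2 ht
    simp only [h3 m]
    rw [dualAct_eq_integral_rho φ hs, integral_quadrants hF hG h1 h2 hs]
    simp only [Phi, bfun, neg_mul]
end
end
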